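/- arXiv:2110.09068 — 4 statements merged into one kernel-verified Lean document; each statement's English description precedes it below -/
import Mathlib

section
/- For all fixed reals 0 < α < 1/2 and 0 < ρ < 1 there exist constants c, k, n₀ ∈ ℕ such that the following holds for every n ≥ n₀, every integer r with 2 ≤ r ≤ (1−ρ)n, and all ℓ, u ∈ ℕⁿ with [ℓᵢ,uᵢ] ⊆ [r − r^α, r + r^α] and uᵢ ≤ ℓᵢ + 1 for all i. Let m, m' ∈ ℕ with |m − m'| = 1, Σᵢℓᵢ ≤ 2·min(m,m'), and 2·max(m,m') ≤ Σᵢuᵢ. Let ∂_m(G_{m'}(ℓ,u)) denote the set of graphs G' ∈ G_{m'}(ℓ,u) for which there exists G ∈ G_m(ℓ,u) whose edge set differs from E(G') by the addition (if m' = m+1) or deletion (if m' = m−1) of a single edge. Then c · n^k · |∂_m(G_{m'}(ℓ,u))| ≥ |G_{m'}(ℓ,u)|. -/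
/-- The degree of vertex `i` in a simple graph on `Fin n`. -/
noncomputable def degOf {n : ℕ} (G : SimpleGraph (Fin n)) (i : Fin n) : ℕ :=
  (G.neighborSet i).ncard

/-- `Gm n ℓ u m`: graphs on `[n]` with exactly `m` edges and degrees within `[ℓ,u]`. -/
noncomputable def Gm (n : ℕ) (ℓ u : Fin n → ℕ) (m : ℕ) : Set (SimpleGraph (Fin n)) :=
  {G | (∀ i, ℓ i ≤ degOf G i ∧ degOf G i ≤ u i) ∧ G.edgeSet.ncard = m}

/-- `∂_m(G_{m'}(ℓ,u))`: graphs in `G_{m'}(ℓ,u)` whose edge set differs from that of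
some graph in `G_m(ℓ,u)` by a single edge (addition or deletion). -/
noncomputable def addDelBoundary (n : ℕ) (ℓ u : Fin n → ℕ) (m m' : ℕ) :
    Set (SimpleGraph (Fin n)) :=
  {G' | G' ∈ Gm n ℓ u m' ∧ ∃ G ∈ Gm n ℓ u m,
    (symmDiff G.edgeSet G'.edgeSet).ncard = 1}

open Finset in
/-- In a graph with nearly equal degrees, any two vertices `x`, `y` are joined by an alternating
walk of three or five steps which starts and ends with an edge. -/
lemma exists_alternating_walk {V : Type*} [Fintype V] [DecidableEq V] (G : SimpleGraph V)
    [DecidableRel G.Adj] {p q s : ℕ} (hV : Fintype.card V = p + q + s)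
    (hp : ∀ v, p ≤ G.degree v) (hs : ∀ v, G.degree v < p + s) (hpq : 9 * s ^ 2 < p * q)
    (x y : V) :
    ∃ a b, G.Adj x a ∧ G.Adj y b ∧ ((a ≠ b ∧ ¬ G.Adj a b) ∨
      ∃ c d, a ≠ c ∧ ¬ G.Adj a c ∧ G.Adj c d ∧ b ≠ d ∧ ¬ G.Adj b d) := by
  by_contra! H
  have hp0 : 0 < p := Nat.pos_of_ne_zero (by rintro rfl; simp at hpq)
  have hq0 : 0 < q := Nat.pos_of_ne_zero (by rintro rfl; simp at hpq)
  let far (z : V) : Finset V := {c | ∃ a, G.Adj z a ∧ a ≠ c ∧ ¬ G.Adj a c}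
  have mem_far {z c : V} : c ∈ far z ↔ ∃ a, G.Adj z a ∧ a ≠ c ∧ ¬ G.Adj a c := by simp [far]
  have hfar (z : V) : #(far z)ᶜ ≤ p + s := by
    obtain ⟨a, ha⟩ := (G.degree_pos_iff_exists_adj z).1 (hp0.trans_le (hp z))
    have hsub : (far z)ᶜ ⊆ insert a (G.neighborFinset a) := by
      intro c hc
      rw [mem_compl, mem_far] at hc
      rw [mem_insert, SimpleGraph.mem_neighborFinset]
      grind
    have h1 := (card_le_card hsub).trans (card_insert_le _ _)
    rw [SimpleGraph.card_neighborFinset_eq_degree] at h1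
    exact h1.trans (hs a)
  have hcard (z : V) : #(far z) + #(far z)ᶜ = p + q + s := by rw [card_add_card_compl, hV]
  have hq (z : V) : q ≤ #(far z) := by have := hcard z; have := hfar z; omega
  have hxy : ∀ c ∈ far x, ∀ d ∈ far y, ¬ G.Adj c d := by
    intro c hc d hd hcd
    obtain ⟨a, ha, hac, hac'⟩ := mem_far.1 hc
    obtain ⟨b, hb, hbd, hbd'⟩ := mem_far.1 hd
    exact hbd' ((H a b ha hb).2 c d hac hac' hcd hbd)
  have hx_sub : ∀ c ∈ far x, G.neighborFinset c ⊆ (far y)ᶜ := by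
    intro c hc d hd
    rw [SimpleGraph.mem_neighborFinset] at hd
    rw [mem_compl]
    exact fun h => hxy c hc d h hd
  have hy_sub : ∀ d ∈ far y, G.neighborFinset d ⊆ (far x)ᶜ := by
    intro d hd c hc
    rw [SimpleGraph.mem_neighborFinset] at hc
    rw [mem_compl]
    exact fun h => hxy c h d hd hc.symm
  have hC : #(far x) ≤ q + s := by
    obtain ⟨d, hd⟩ := card_pos.1 (hq0.trans_le (hq y))
    have h1 := card_le_card (hy_sub d hd)
    rw [SimpleGraph.card_neighborFinset_eq_degree] at h1
    have := hp d
    have := hcard x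
    omega
  have hnonadj : #(G.neighborFinset x) * q ≤ #(far x) * s := by
    refine card_mul_le_card_mul (fun a c => a ≠ c ∧ ¬ G.Adj a c) (fun a ha => ?_) (fun c hc => ?_)
    · have hsub : (insert a (G.neighborFinset a))ᶜ ⊆
          bipartiteAbove (fun a c => a ≠ c ∧ ¬ G.Adj a c) (far x) a := by
        intro c hc
        rw [SimpleGraph.mem_neighborFinset] at ha
        rw [mem_compl, mem_insert, SimpleGraph.mem_neighborFinset] at hc
        rw [mem_bipartiteAbove, mem_far]
        grind
      refine le_trans ?_ (card_le_card hsub)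
      have h1 := card_insert_le a (G.neighborFinset a)
      rw [SimpleGraph.card_neighborFinset_eq_degree] at h1
      have := hs a
      rw [card_compl, hV]
      omega
    · have hsub : bipartiteBelow (fun a c => a ≠ c ∧ ¬ G.Adj a c) (G.neighborFinset x) c ⊆
          (far y)ᶜ \ G.neighborFinset c := by
        intro a ha
        rw [mem_bipartiteBelow, SimpleGraph.mem_neighborFinset] at ha
        rw [mem_sdiff, mem_compl, mem_far, SimpleGraph.mem_neighborFinset]
        refine ⟨?_, fun h => ha.2.2 h.symm⟩
        rintro ⟨b, hb, hba, hba'⟩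
        exact hba' ((H a b ha.1 hb).1 hba.symm).symm
      refine (card_le_card hsub).trans ?_
      rw [card_sdiff_of_subset (hx_sub c hc), SimpleGraph.card_neighborFinset_eq_degree]
      have := hp c
      have := hfar y
      omega
  have hadj : #(far y) * p ≤ #(far x)ᶜ * (p + s) := by
    refine card_mul_le_card_mul G.Adj (fun d hd => ?_) (fun c hc => ?_)
    · refine (hp d).trans ?_
      rw [← SimpleGraph.card_neighborFinset_eq_degree]
      refine card_le_card fun c hc => ?_
      have := hy_sub d hd hc
      rw [SimpleGraph.mem_neighborFinset] at hc
      rw [mem_bipartiteAbove]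
      exact ⟨this, hc⟩
    · refine le_trans ?_ (hs c).le
      rw [← SimpleGraph.card_neighborFinset_eq_degree]
      refine card_le_card fun d hd => ?_
      rw [mem_bipartiteBelow] at hd
      rw [SimpleGraph.mem_neighborFinset]
      exact hd.2.symm
  have h1 : p * q ≤ (q + s) * s := by
    refine le_trans ?_ (hnonadj.trans (Nat.mul_le_mul_right s hC))
    rw [SimpleGraph.card_neighborFinset_eq_degree]
    exact Nat.mul_le_mul_right q (hp x)
  have h2 : q * p ≤ (p + s) * (p + s) :=
    (Nat.mul_le_mul_right p (hq y)).trans (hadj.trans (Nat.mul_le_mul_right _ (hfar x)))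
  rcases le_total q s with hqs | hqs
  · nlinarith
  · have : p ≤ 2 * s := by
      refine Nat.le_of_mul_le_mul_right (c := q) ?_ hq0
      nlinarith
    nlinarith

/-- The closed walk of length four through the given vertices, as a graph. -/
def fourCycle {V : Type*} (v : V × V × V × V) : SimpleGraph V :=
  SimpleGraph.fromEdgeSet {s(v.1, v.2.1), s(v.2.1, v.2.2.1), s(v.2.2.1, v.2.2.2), s(v.2.2.2, v.1)}

lemma symmDiff_adj {V : Type*} (G H : SimpleGraph V) (v w : V) :
    (symmDiff G H).Adj v w ↔ (G.Adj v w ∧ ¬ H.Adj v w) ∨ (H.Adj v w ∧ ¬ G.Adj v w) := by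
  simp [symmDiff_def]

lemma fourCycle_adj {V : Type*} {x a b y v w : V} :
    (fourCycle (x, a, b, y)).Adj v w ↔
      (s(v, w) = s(x, a) ∨ s(v, w) = s(a, b) ∨ s(v, w) = s(b, y) ∨ s(v, w) = s(y, x)) ∧
        v ≠ w := by
  simp [fourCycle]

lemma fourCycle_self {V : Type*} (x : V) : fourCycle (x, x, x, x) = ⊥ := by
  ext v w
  rw [fourCycle_adj]
  simp
  grind

lemma degOf_eq_of_neighborSet {n : ℕ} {G H : SimpleGraph (Fin n)} {v w z : Fin n}
    (hw : G.Adj v w) (hz : ¬ G.Adj v z)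
    (h : H.neighborSet v = insert z (G.neighborSet v \ {w})) : degOf H v = degOf G v := by
  unfold degOf
  rw [h, Set.ncard_insert_of_notMem (fun hz' => hz hz'.1) (Set.toFinite _)]
  exact Set.ncard_sdiff_singleton_add_one hw (Set.toFinite _)

lemma degOf_symmDiff_fourCycle {n : ℕ} {G : SimpleGraph (Fin n)} {x a b y : Fin n}
    (hxa : G.Adj x a) (hyb : G.Adj y b) (hab : a ≠ b) (hab' : ¬ G.Adj a b) (hxy : x ≠ y)
    (hxy' : ¬ G.Adj x y) (v : Fin n) :
    degOf (symmDiff G (fourCycle (x, a, b, y))) v = degOf G v := by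
  have h1 := hxa.ne
  have h2 := hyb.ne
  have h3 : x ≠ b := by rintro rfl; exact hab' hxa.symm
  have h4 : a ≠ y := by rintro rfl; exact hxy' hxa
  have key (w : Fin n) : w ∈ (symmDiff G (fourCycle (x, a, b, y))).neighborSet v ↔ _ :=
    symmDiff_adj G (fourCycle (x, a, b, y)) v w
  simp only [fourCycle_adj, Sym2.eq_iff] at key
  by_cases hvx : v = x
  · subst hvx
    refine degOf_eq_of_neighborSet hxa hxy' (Set.ext fun w => (key w).trans ?_)
    simp only [Set.mem_insert_iff, Set.mem_sdiff, SimpleGraph.mem_neighborSet, Set.mem_singleton_iff]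
    grind
  by_cases hva : v = a
  · subst hva
    refine degOf_eq_of_neighborSet hxa.symm hab' (Set.ext fun w => (key w).trans ?_)
    simp only [Set.mem_insert_iff, Set.mem_sdiff, SimpleGraph.mem_neighborSet, Set.mem_singleton_iff]
    grind [G.adj_comm]
  by_cases hvb : v = b
  · subst hvb
    refine degOf_eq_of_neighborSet hyb.symm (fun h => hab' h.symm)
      (Set.ext fun w => (key w).trans ?_)
    simp only [Set.mem_insert_iff, Set.mem_sdiff, SimpleGraph.mem_neighborSet, Set.mem_singleton_iff]
    grind [G.adj_comm]
  by_cases hvy : v = y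
  · subst hvy
    refine degOf_eq_of_neighborSet hyb (fun h => hxy' h.symm) (Set.ext fun w => (key w).trans ?_)
    simp only [Set.mem_insert_iff, Set.mem_sdiff, SimpleGraph.mem_neighborSet, Set.mem_singleton_iff]
    grind [G.adj_comm]
  · unfold degOf
    congr 1
    refine Set.ext fun w => (key w).trans ?_
    rw [SimpleGraph.mem_neighborSet]
    grind

lemma symmDiff_fourCycle_adj {V : Type*} {G : SimpleGraph V} {x a b y : V} (hxy : x ≠ y)
    (hxy' : ¬ G.Adj x y) : (symmDiff G (fourCycle (x, a, b, y))).Adj x y := by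
  rw [symmDiff_adj, fourCycle_adj]
  simp [hxy, hxy', Sym2.eq_swap]

lemma degOf_eq_degree {n : ℕ} (G : SimpleGraph (Fin n)) [DecidableRel G.Adj] (v : Fin n) :
    degOf G v = G.degree v := by
  rw [degOf, Set.ncard_eq_toFinset_card', ← SimpleGraph.neighborFinset,
    SimpleGraph.card_neighborFinset_eq_degree]

/-- Two nonadjacent vertices of a graph with nearly equal degrees become adjacent after at most
two degree-preserving switchings. -/
lemma exists_switchings_adj {n p q s : ℕ} (hn : n = p + q + s) (hpq : 9 * s ^ 2 < p * q)
    {G : SimpleGraph (Fin n)} (hp : ∀ v, p ≤ degOf G v) (hs : ∀ v, degOf G v < p + s)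
    {x y : Fin n} (hxy : x ≠ y) (hxy' : ¬ G.Adj x y) :
    ∃ v w, (∀ i, degOf (symmDiff (symmDiff G (fourCycle v)) (fourCycle w)) i = degOf G i) ∧
      (symmDiff (symmDiff G (fourCycle v)) (fourCycle w)).Adj x y := by
  classical
  simp only [degOf_eq_degree G] at hp hs
  have single {a b : Fin n} (hxa : G.Adj x a) (hyb : G.Adj y b) (hab : a ≠ b)
      (hab' : ¬ G.Adj a b) : ∃ v w,
        (∀ i, degOf (symmDiff (symmDiff G (fourCycle v)) (fourCycle w)) i = degOf G i) ∧
          (symmDiff (symmDiff G (fourCycle v)) (fourCycle w)).Adj x y := by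
    refine ⟨(x, x, x, x), (x, a, b, y), ?_⟩
    rw [fourCycle_self, symmDiff_bot]
    exact ⟨degOf_symmDiff_fourCycle hxa hyb hab hab' hxy hxy', symmDiff_fourCycle_adj hxy hxy'⟩
  obtain ⟨a, b, hxa, hyb, ⟨hab, hab'⟩ | ⟨c, d, hac, hac', hcd, hbd, hbd'⟩⟩ :=
    exists_alternating_walk G (by simpa using hn) hp hs hpq x y
  · exact single hxa hyb hab hab'
  have hda : d ≠ a := by rintro rfl; exact hac' hcd.symm
  have hcb : c ≠ b := by rintro rfl; exact hbd' hcd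
  have hay : a ≠ y := by rintro rfl; exact hxy' hxa
  have hbx : b ≠ x := by rintro rfl; exact hxy' hyb.symm
  have hax := hxa.ne
  have hby := hyb.ne
  have hcd_ne := hcd.ne
  have hcx : c ≠ x := by rintro rfl; exact hac' hxa.symm
  have hdy : d ≠ y := by rintro rfl; exact hbd' hyb.symm
  by_cases hab : a = b
  · subst hab
    have hxd : x ≠ d := by rintro rfl; exact hbd' hxa.symm
    have hcy : c ≠ y := by rintro rfl; exact hac' hyb.symm
    by_cases hxd' : G.Adj x d
    · exact single hxd' hyb hda (fun h => hbd' h.symm)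
    refine ⟨(x, a, c, d), (x, d, a, y), ?_⟩
    have hdeg := degOf_symmDiff_fourCycle hxa hcd.symm hac hac' hxd hxd'
    have h1 : ¬ (symmDiff G (fourCycle (x, a, c, d))).Adj x y := by
      rw [symmDiff_adj, fourCycle_adj]; simp only [Sym2.eq_iff]; grind [G.adj_comm]
    refine ⟨fun i => ?_, symmDiff_fourCycle_adj hxy h1⟩
    rw [← hdeg i]
    refine degOf_symmDiff_fourCycle (symmDiff_fourCycle_adj hxd hxd') ?_ hda ?_ hxy h1 i
    · rw [symmDiff_adj, fourCycle_adj]; simp only [Sym2.eq_iff]; grind [G.adj_comm]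
    · rw [symmDiff_adj, fourCycle_adj]; simp only [Sym2.eq_iff]; grind [G.adj_comm]
  by_cases hab' : G.Adj a b
  · refine ⟨(a, b, d, c), (x, a, b, y), ?_⟩
    have hdeg := degOf_symmDiff_fourCycle hab' hcd hbd hbd' hac hac'
    have h1 : ¬ (symmDiff G (fourCycle (a, b, d, c))).Adj x y := by
      rw [symmDiff_adj, fourCycle_adj]; simp only [Sym2.eq_iff]; grind [G.adj_comm]
    refine ⟨fun i => ?_, symmDiff_fourCycle_adj hxy h1⟩
    rw [← hdeg i]
    refine degOf_symmDiff_fourCycle ?_ ?_ hab ?_ hxy h1 i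
    · rw [symmDiff_adj, fourCycle_adj]; simp only [Sym2.eq_iff]; grind [G.adj_comm]
    · rw [symmDiff_adj, fourCycle_adj]; simp only [Sym2.eq_iff]; grind [G.adj_comm]
    · rw [symmDiff_adj, fourCycle_adj]; simp only [Sym2.eq_iff]; grind [G.adj_comm]
  · exact single hxa hyb hab hab'

lemma degOf_compl {n : ℕ} (G : SimpleGraph (Fin n)) (v : Fin n) :
    degOf Gᶜ v + degOf G v + 1 = n := by
  classical
  rw [degOf_eq_degree, degOf_eq_degree, G.degree_compl]
  have := G.degree_lt_card_verts v
  rw [Fintype.card_fin] at *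
  omega

lemma compl_symmDiff_left {V : Type*} (G H : SimpleGraph V) : (symmDiff G H)ᶜ = symmDiff Gᶜ H := by
  ext v w
  simp only [SimpleGraph.compl_adj, symmDiff_adj]
  have := H.ne_of_adj (a := v) (b := w)
  tauto

/-- Two adjacent vertices of a graph with nearly equal degrees become nonadjacent after at most
two degree-preserving switchings. -/
lemma exists_switchings_not_adj {n p q s : ℕ} (hn : n = p + q + s) (hpq : 9 * s ^ 2 < p * q)
    {G : SimpleGraph (Fin n)} (hp : ∀ v, p ≤ degOf G v) (hs : ∀ v, degOf G v < p + s)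
    {x y : Fin n} (hxy : G.Adj x y) :
    ∃ v w, (∀ i, degOf (symmDiff (symmDiff G (fourCycle v)) (fourCycle w)) i = degOf G i) ∧
      ¬ (symmDiff (symmDiff G (fourCycle v)) (fourCycle w)).Adj x y := by
  obtain ⟨v, w, hdeg, hadj⟩ := exists_switchings_adj (n := n) (p := q) (q := p) (s := s)
    (by omega) (by rwa [mul_comm q p]) (G := Gᶜ)
    (fun v => by have := degOf_compl G v; have := hs v; omega)
    (fun v => by have := degOf_compl G v; have := hp v; omega) hxy.ne (by simp [hxy])
  rw [← compl_symmDiff_left, ← compl_symmDiff_left] at hdeg hadj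
  refine ⟨v, w, fun i => ?_, ?_⟩
  · have h1 := hdeg i
    have h2 := degOf_compl G i
    have h3 := degOf_compl (symmDiff (symmDiff G (fourCycle v)) (fourCycle w)) i
    omega
  · rw [SimpleGraph.compl_adj] at hadj
    exact hadj.2

lemma sum_degOf {n : ℕ} (G : SimpleGraph (Fin n)) : ∑ i, degOf G i = 2 * G.edgeSet.ncard := by
  classical
  simp only [degOf_eq_degree]
  rw [G.sum_degrees_eq_twice_card_edges, ← SimpleGraph.coe_edgeFinset, Set.ncard_coe_finset]

lemma Gm_congr_degOf {n m : ℕ} {ℓ u : Fin n → ℕ} {G H : SimpleGraph (Fin n)}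
    (h : ∀ i, degOf H i = degOf G i) (hG : G ∈ Gm n ℓ u m) : H ∈ Gm n ℓ u m := by
  refine ⟨fun i => by rw [h]; exact hG.1 i, ?_⟩
  have h1 := sum_degOf H
  simp only [h, sum_degOf G, hG.2] at h1
  omega

lemma degOf_deleteEdges {n : ℕ} {G : SimpleGraph (Fin n)} {x y : Fin n} (hxy : G.Adj x y)
    (v : Fin n) :
    degOf (G.deleteEdges {s(x, y)}) v + (if v = x ∨ v = y then 1 else 0) = degOf G v := by
  have hne := hxy.ne
  unfold degOf
  have key (w : Fin n) : w ∈ (G.deleteEdges {s(x, y)}).neighborSet v ↔ _ :=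
    SimpleGraph.deleteEdges_adj
  simp only [Set.mem_singleton_iff, Sym2.eq_iff] at key
  by_cases hvx : v = x
  · subst hvx
    rw [if_pos (Or.inl rfl), ←
      Set.ncard_sdiff_singleton_add_one ((G.mem_neighborSet v y).2 hxy) (Set.toFinite _)]
    congr 2
    refine Set.ext fun w => (key w).trans ?_
    simp only [Set.mem_sdiff, SimpleGraph.mem_neighborSet, Set.mem_singleton_iff]
    grind
  by_cases hvy : v = y
  · subst hvy
    rw [if_pos (Or.inr rfl), ←
      Set.ncard_sdiff_singleton_add_one ((G.mem_neighborSet v x).2 hxy.symm) (Set.toFinite _)]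
    congr 2
    refine Set.ext fun w => (key w).trans ?_
    simp only [Set.mem_sdiff, SimpleGraph.mem_neighborSet, Set.mem_singleton_iff]
    grind
  · rw [if_neg (by tauto), add_zero]
    congr 1
    refine Set.ext fun w => (key w).trans ?_
    rw [SimpleGraph.mem_neighborSet]
    grind

lemma ncard_edgeSet_deleteEdges {n : ℕ} {G : SimpleGraph (Fin n)} {x y : Fin n}
    (hxy : G.Adj x y) : (G.deleteEdges {s(x, y)}).edgeSet.ncard + 1 = G.edgeSet.ncard := by
  rw [SimpleGraph.edgeSet_deleteEdges]
  exact Set.ncard_sdiff_singleton_add_one hxy (Set.toFinite _)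

lemma ncard_symmDiff_deleteEdges {n : ℕ} {G : SimpleGraph (Fin n)} {x y : Fin n}
    (hxy : G.Adj x y) :
    (symmDiff (G.deleteEdges {s(x, y)}).edgeSet G.edgeSet).ncard = 1 := by
  have hsub : {s(x, y)} ⊆ G.edgeSet := Set.singleton_subset_iff.2 hxy
  rw [SimpleGraph.edgeSet_deleteEdges, Set.symmDiff_def, Set.sdiff_sdiff_right_self,
    Set.inter_eq_right.2 hsub, Set.sdiff_eq_empty.2 Set.sdiff_subset,
    Set.empty_union, Set.ncard_singleton]

lemma mem_boundary_of_adj {n m m' : ℕ} {ℓ u : Fin n → ℕ} {G : SimpleGraph (Fin n)}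
    (hm : m' = m + 1) (hG : G ∈ Gm n ℓ u m') {x y : Fin n} (hx : ℓ x < degOf G x)
    (hy : ℓ y < degOf G y) (hxy : G.Adj x y) : G ∈ addDelBoundary n ℓ u m m' := by
  refine ⟨hG, G.deleteEdges {s(x, y)}, ⟨fun i => ?_, ?_⟩, ncard_symmDiff_deleteEdges hxy⟩
  · have h1 := degOf_deleteEdges hxy i
    have h2 := hG.1 i
    split_ifs at h1 with h
    · rcases h with rfl | rfl <;> omega
    · omega
  · have h1 := ncard_edgeSet_deleteEdges hxy
    have h2 := hG.2
    omega

lemma mem_boundary_of_not_adj {n m m' : ℕ} {ℓ u : Fin n → ℕ} {G : SimpleGraph (Fin n)}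
    (hm : m = m' + 1) (hG : G ∈ Gm n ℓ u m') {x y : Fin n} (hne : x ≠ y)
    (hx : degOf G x < u x) (hy : degOf G y < u y) (hxy : ¬ G.Adj x y) :
    G ∈ addDelBoundary n ℓ u m m' := by
  let G₁ := G ⊔ SimpleGraph.edge x y
  have hadj : G₁.Adj x y := Or.inr (by simp [SimpleGraph.edge_adj, hne])
  have hdel : G₁.deleteEdges {s(x, y)} = G := by
    ext v w
    simp only [G₁, SimpleGraph.deleteEdges_adj, SimpleGraph.sup_adj, SimpleGraph.edge_adj,
      Set.mem_singleton_iff, Sym2.eq_iff]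
    grind [G.adj_comm]
  refine ⟨hG, G₁, ⟨fun i => ?_, ?_⟩, ?_⟩
  · have h1 := degOf_deleteEdges hadj i
    have h2 := hG.1 i
    rw [hdel] at h1
    split_ifs at h1 with h
    · rcases h with rfl | rfl <;> omega
    · omega
  · have h1 := ncard_edgeSet_deleteEdges hadj
    have h2 := hG.2
    rw [hdel] at h1
    omega
  · have h1 := ncard_symmDiff_deleteEdges hadj
    rwa [hdel, symmDiff_comm] at h1

lemma exists_ne_lt_of_sum_add_two_le {ι : Type*} [Fintype ι] {f g : ι → ℕ} (hfg : ∀ i, g i ≤ f i + 1)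
    (h : ∑ i, f i + 2 ≤ ∑ i, g i) : ∃ x y, x ≠ y ∧ f x < g x ∧ f y < g y := by
  classical
  obtain ⟨x, -, hx⟩ := Finset.exists_lt_of_sum_lt (s := Finset.univ) (f := f) (g := g) (by omega)
  have h1 := Finset.add_sum_erase Finset.univ f (Finset.mem_univ x)
  have h2 := Finset.add_sum_erase Finset.univ g (Finset.mem_univ x)
  have h3 := hfg x
  obtain ⟨y, hy, hy'⟩ := Finset.exists_lt_of_sum_lt (s := Finset.univ.erase x) (f := f) (g := g)
    (by omega)
  exact ⟨x, y, (Finset.ne_of_mem_erase hy).symm, hx, hy'⟩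

/-- Every graph in `Gm n ℓ u m'` is at most two switchings away from the boundary. -/
lemma exists_switchings_mem_boundary {n p q s m m' : ℕ} {ℓ u : Fin n → ℕ} (hn : n = p + q + s)
    (hpq : 9 * s ^ 2 < p * q) (hp : ∀ i, p ≤ ℓ i) (hs : ∀ i, u i < p + s)
    (hu : ∀ i, u i ≤ ℓ i + 1) (hm : m' = m + 1 ∨ m = m' + 1) (hℓm : ∑ i, ℓ i ≤ 2 * min m m')
    (hum : 2 * max m m' ≤ ∑ i, u i) {G : SimpleGraph (Fin n)} (hG : G ∈ Gm n ℓ u m') :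
    ∃ v w, symmDiff (symmDiff G (fourCycle v)) (fourCycle w) ∈ addDelBoundary n ℓ u m m' := by
  have hp' : ∀ i, p ≤ degOf G i := fun i => (hp i).trans (hG.1 i).1
  have hs' : ∀ i, degOf G i < p + s := fun i => (hG.1 i).2.trans_lt (hs i)
  have hsum := sum_degOf G
  rw [hG.2] at hsum
  have trivial_switch (x : Fin n) :
      symmDiff (symmDiff G (fourCycle (x, x, x, x))) (fourCycle (x, x, x, x)) = G := by
    rw [fourCycle_self, symmDiff_bot, symmDiff_bot]
  rcases hm with hm | hm
  · obtain ⟨x, y, hne, hx, hy⟩ := exists_ne_lt_of_sum_add_two_le (f := ℓ) (g := degOf G)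
      (fun i => (hG.1 i).2.trans (hu i)) (by omega)
    by_cases hxy : G.Adj x y
    · refine ⟨(x, x, x, x), (x, x, x, x), ?_⟩
      rw [trivial_switch]
      exact mem_boundary_of_adj hm hG hx hy hxy
    · obtain ⟨v, w, hdeg, hadj⟩ := exists_switchings_adj hn hpq hp' hs' hne hxy
      exact ⟨v, w, mem_boundary_of_adj hm (Gm_congr_degOf hdeg hG) (by rwa [hdeg])
        (by rwa [hdeg]) hadj⟩
  · obtain ⟨x, y, hne, hx, hy⟩ := exists_ne_lt_of_sum_add_two_le (f := degOf G) (g := u)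
      (fun i => (hu i).trans (Nat.succ_le_succ (hG.1 i).1)) (by omega)
    by_cases hxy : G.Adj x y
    · obtain ⟨v, w, hdeg, hadj⟩ := exists_switchings_not_adj hn hpq hp' hs' hxy
      exact ⟨v, w, mem_boundary_of_not_adj hm (Gm_congr_degOf hdeg hG) hne (by rwa [hdeg])
        (by rwa [hdeg]) hadj⟩
    · refine ⟨(x, x, x, x), (x, x, x, x), ?_⟩
      rw [trivial_switch]
      exact mem_boundary_of_not_adj hm hG hne hx hy hxy

lemma ncard_le_of_exists_switchings {n : ℕ} {A B : Set (SimpleGraph (Fin n))}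
    (h : ∀ G ∈ A, ∃ v w, symmDiff (symmDiff G (fourCycle v)) (fourCycle w) ∈ B) :
    A.ncard ≤ n ^ 8 * B.ncard := by
  let F (t : SimpleGraph (Fin n) × (Fin n × Fin n × Fin n × Fin n) ×
      (Fin n × Fin n × Fin n × Fin n)) : SimpleGraph (Fin n) :=
    symmDiff (symmDiff t.1 (fourCycle t.2.2)) (fourCycle t.2.1)
  have hsub : A ⊆ F '' (B ×ˢ Set.univ) := by
    intro G hG
    obtain ⟨v, w, hvw⟩ := h G hG
    refine ⟨(symmDiff (symmDiff G (fourCycle v)) (fourCycle w), v, w), ⟨hvw, Set.mem_univ _⟩, ?_⟩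
    simp only [F, symmDiff_symmDiff_cancel_right]
  calc A.ncard ≤ (F '' (B ×ˢ Set.univ)).ncard := Set.ncard_le_ncard hsub (Set.toFinite _)
    _ ≤ (B ×ˢ (Set.univ : Set ((Fin n × Fin n × Fin n × Fin n) ×
          (Fin n × Fin n × Fin n × Fin n)))).ncard := Set.ncard_image_le (Set.toFinite _)
    _ = n ^ 8 * B.ncard := by
      rw [Set.ncard_prod, Set.ncard_univ]
      simp only [Nat.card_prod, Nat.card_fin]
      ring

lemma near_regular_bounds {α ρ : ℝ} (hα : α < 1 / 2) (hρ0 : 0 < ρ) (hρ : ρ < 1) {n r : ℕ}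
    (hn : 400 / ρ ^ 2 ≤ n) (hr : 2 ≤ r) (hrn : (r : ℝ) ≤ (1 - ρ) * n) :
    ∃ p q s : ℕ, n = p + q + s ∧ 9 * s ^ 2 < p * q ∧
      (∀ k : ℕ, (r : ℝ) - (r : ℝ) ^ α ≤ k → p ≤ k) ∧
      ∀ k : ℕ, (k : ℝ) ≤ (r : ℝ) + (r : ℝ) ^ α → k < p + s := by
  set t := Nat.sqrt r with ht
  have htr : t * t ≤ r := Nat.sqrt_le r
  have hrα : (r : ℝ) ^ α ≤ √r := by
    rw [Real.sqrt_eq_rpow]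
    exact Real.rpow_le_rpow_of_exponent_le (by exact_mod_cast (by omega : 1 ≤ r)) hα.le
  have sq_lt : √(r : ℝ) < t + 1 := by
    rw [Real.sqrt_lt' (by positivity)]
    have h2 : r < (t + 1) * (t + 1) := Nat.lt_succ_sqrt r
    have h3 : (r : ℝ) < (t + 1) * (t + 1) := by exact_mod_cast h2
    linarith
  have ht2 : 2 * t ≤ r := by
    rcases Nat.lt_or_ge t 2 with h | h
    · omega
    · nlinarith
  have hρn : 400 ≤ ρ ^ 2 * n := by
    rw [div_le_iff₀ (by positivity)] at hn
    linarith
  have hn0 : (0 : ℝ) ≤ n := Nat.cast_nonneg n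
  have htn : (20 * t : ℝ) ≤ ρ * n := by
    have h1 : (t * t : ℝ) ≤ r := by exact_mod_cast htr
    have h2 : (r : ℝ) ≤ n := by nlinarith
    refine abs_le_of_sq_le_sq' ?_ (by positivity) |>.2
    nlinarith
  have hbig : (400 : ℝ) ≤ ρ * n := by nlinarith
  have hq : r + t + 170 ≤ n := by
    have : (r + t + 170 : ℝ) ≤ n := by nlinarith
    exact_mod_cast this
  refine ⟨r - t, n - 1 - r - t, 2 * t + 1, by omega, ?_, fun k hk => ?_, fun k hk => ?_⟩
  · obtain ⟨p, hp⟩ : ∃ p, r = p + t := ⟨r - t, by omega⟩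
    obtain ⟨q, hq'⟩ : ∃ q, n = q + 1 + r + t := ⟨n - 1 - r - t, by omega⟩
    rw [show r - t = p by omega, show n - 1 - r - t = q by omega]
    have h1 : 169 ≤ q := by omega
    have h2 : p * 169 ≤ p * q := Nat.mul_le_mul_left p h1
    nlinarith
  · have : (r : ℝ) < (k + t + 1 : ℕ) := by push_cast; linarith
    have : r < k + t + 1 := by exact_mod_cast this
    omega
  · have : (k : ℝ) < (r + t + 1 : ℕ) := by push_cast; linarith
    have : k < r + t + 1 := by exact_mod_cast this
    omega

/-- For near-regular degree intervals of size at most one, and adjacent feasible edge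
counts `m, m'`, the addition/deletion boundary of `G_{m'}(ℓ,u)` is at least a
polynomial fraction of `G_{m'}(ℓ,u)`. -/
theorem addDel_boundary_large (α ρ : ℝ) (hα0 : 0 < α) (hα : α < 1 / 2)
    (hρ0 : 0 < ρ) (hρ : ρ < 1) :
    ∃ c k n₀ : ℕ, 0 < c ∧ ∀ n : ℕ, n₀ ≤ n → ∀ r : ℕ, 2 ≤ r → (r : ℝ) ≤ (1 - ρ) * n →
      ∀ ℓ u : Fin n → ℕ,
        (∀ i, ℓ i ≤ u i ∧ (r : ℝ) - (r : ℝ) ^ α ≤ (ℓ i : ℝ) ∧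
          (u i : ℝ) ≤ (r : ℝ) + (r : ℝ) ^ α ∧ u i ≤ ℓ i + 1) →
        ∀ m m' : ℕ, (m' = m + 1 ∨ m = m' + 1) →
          (∑ i, ℓ i) ≤ 2 * min m m' → 2 * max m m' ≤ (∑ i, u i) →
          c * n ^ k * (addDelBoundary n ℓ u m m').ncard ≥ (Gm n ℓ u m').ncard := by
  refine ⟨1, 8, ⌈400 / ρ ^ 2⌉₊, one_pos, ?_⟩
  intro n hn r hr hrn ℓ u hℓu m m' hm hℓm hum
  obtain ⟨p, q, s, hpqs, hpq, hp, hs⟩ := near_regular_bounds hα hρ0 hρ (Nat.ceil_le.1 hn) hr hrn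
  rw [one_mul]
  exact ncard_le_of_exists_switchings fun G hG =>
    exists_switchings_mem_boundary hpqs hpq (fun i => hp _ (hℓu i).2.1)
      (fun i => hs _ (hℓu i).2.2.1) (fun i => (hℓu i).2.2.2) hm hℓm hum hG
end

section
/- Let N ∈ ℕ and let w₁, …, w_N be positive reals satisfying w_{m−1} · w_{m+1} ≤ w_m² for all 1 < m < N. Then for every z with 1 ≤ z ≤ N, the double sum satisfies Σ_{i=1}^{z} Σ_{j=z+1}^{N} w_i · w_j ≤ N² · w_z · Σ_{p=1}^{N} w_p. -/
open Finset

/-- Consecutive ratios of a log-concave sequence of positive reals decrease. -/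
lemma logconcave_mul_succ_le {N : ℕ} {w : ℕ → ℝ}
    (hpos : ∀ m, 1 ≤ m → m ≤ N → 0 < w m)
    (hlc : ∀ m, 1 < m → m < N → w (m - 1) * w (m + 1) ≤ (w m) ^ 2)
    {a b : ℕ} (ha : 1 ≤ a) (hab : a ≤ b) (hb : b + 1 ≤ N) :
    w a * w (b + 1) ≤ w (a + 1) * w b := by
  induction b, hab using Nat.le_induction with
  | base => exact (mul_comm _ _).le
  | succ b hab ih =>
    have h₁ := ih (by omega)
    have h₂ : w b * w (b + 1 + 1) ≤ w (b + 1) ^ 2 := hlc (b + 1) (by omega) (by omega)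
    have hb₀ : 0 < w b := hpos b (by omega) (by omega)
    have ha₀ : 0 < w a := hpos a ha (by omega)
    have hb₁ : 0 < w (b + 1) := hpos (b + 1) (by omega) (by omega)
    refine le_of_mul_le_mul_right ?_ hb₀
    calc w a * w (b + 1 + 1) * w b = w a * (w b * w (b + 1 + 1)) := by ring
      _ ≤ w a * w (b + 1) ^ 2 := by gcongr
      _ = w a * w (b + 1) * w (b + 1) := by ring
      _ ≤ w (a + 1) * w b * w (b + 1) := by gcongr
      _ = w (a + 1) * w (b + 1) * w b := by ring

/-- In a log-concave sequence of positive reals, moving two indices towards each other by the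
same amount does not decrease the product. -/
lemma logconcave_mul_add_le {N : ℕ} {w : ℕ → ℝ}
    (hpos : ∀ m, 1 ≤ m → m ≤ N → 0 < w m)
    (hlc : ∀ m, 1 < m → m < N → w (m - 1) * w (m + 1) ≤ (w m) ^ 2)
    {i m k : ℕ} (hi : 1 ≤ i) (him : i ≤ m) (hm : m + k ≤ N) :
    w i * w (m + k) ≤ w (i + k) * w m := by
  induction k generalizing i with
  | zero => exact le_rfl
  | succ k ih =>
    obtain rfl | hlt := him.eq_or_lt
    · exact (mul_comm _ _).le
    · have h := ih (i := i + 1) (by omega) hlt (by omega)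
      rw [show i + 1 + k = i + (k + 1) by omega] at h
      exact (logconcave_mul_succ_le hpos hlc (b := m + k) hi (by omega) hm).trans h

/-- For a log-concave sequence of positive reals, the double sum over a split of the
index set is bounded by `N² · w_z · Σ_p w_p`. -/
theorem logconcave_double_sum_bound (N : ℕ) (w : ℕ → ℝ)
    (hpos : ∀ m, 1 ≤ m → m ≤ N → 0 < w m)
    (hlc : ∀ m, 1 < m → m < N → w (m - 1) * w (m + 1) ≤ (w m) ^ 2)
    (z : ℕ) (hz1 : 1 ≤ z) (hzN : z ≤ N) :
    ∑ i ∈ Finset.Icc 1 z, ∑ j ∈ Finset.Icc (z + 1) N, w i * w j ≤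
      (N : ℝ) ^ 2 * w z * ∑ p ∈ Finset.Icc 1 N, w p := by
  have hnonneg : ∀ p ∈ Icc 1 N, 0 ≤ w p := fun p hp =>
    (hpos p (mem_Icc.1 hp).1 (mem_Icc.1 hp).2).le
  have hz₀ : 0 ≤ w z := (hpos z hz1 hzN).le
  have hS : 0 ≤ ∑ p ∈ Icc 1 N, w p := sum_nonneg hnonneg
  have hterm : ∀ i ∈ Icc 1 z, ∀ j ∈ Icc (z + 1) N,
      w i * w j ≤ w z * ∑ p ∈ Icc 1 N, w p := by
    intro i hi j hj
    rw [mem_Icc] at hi hj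
    have h := logconcave_mul_add_le hpos hlc (i := i) (m := i + (j - z)) (k := z - i)
      hi.1 (by omega) (by omega)
    rw [show i + (j - z) + (z - i) = j by omega, show i + (z - i) = z by omega] at h
    exact h.trans (mul_le_mul_of_nonneg_left
      (single_le_sum hnonneg (mem_Icc.2 ⟨by omega, by omega⟩)) hz₀)
  calc ∑ i ∈ Icc 1 z, ∑ j ∈ Icc (z + 1) N, w i * w j
      ≤ ∑ i ∈ Icc 1 z, ∑ j ∈ Icc (z + 1) N, w z * ∑ p ∈ Icc 1 N, w p :=
        sum_le_sum fun i hi => sum_le_sum fun j hj => hterm i hi j hj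
    _ = (z : ℝ) * ((N - z : ℕ) : ℝ) * (w z * ∑ p ∈ Icc 1 N, w p) := by
        simp [mul_assoc]
    _ ≤ (N : ℝ) * (N : ℝ) * (w z * ∑ p ∈ Icc 1 N, w p) := by
        gcongr
        exact Nat.sub_le N z
    _ = (N : ℝ) ^ 2 * w z * ∑ p ∈ Icc 1 N, w p := by ring
end

section
/- Let N ≥ 2 and let w₁, …, w_N be positive reals satisfying w_{m−1} · w_{m+1} ≤ w_m² for all 1 < m < N. Define the N×N real matrix P by P(i,j) = (1/4)·min{1, w_j/w_i} if |i − j| = 1, P(i,j) = 0 if |i − j| > 1, and P(i,i) = 1 − Σ_{j≠i} P(i,j). Let C = max{ w_i/w_j : 1 ≤ i, j ≤ N, |i − j| = 1 }. Then for every real λ ≠ 1 and every nonzero vector v ∈ ℝ^N with P v = λ v, one has λ ≤ 1 − 1/(4 N³ C); equivalently, the spectral gap of the Metropolis birth–death chain P satisfies 1/gap(P) ≤ 4 N³ C. -/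
open Finset

/-- The Metropolis birth–death chain on `{1,…,N}` for weights `w` (state `i : Fin N`
corresponds to index `i.val + 1 ∈ {1,…,N}`): off-diagonal entries
`P(i,j) = (1/4)·min{1, w_j/w_i}` for `|i−j| = 1`, zero for `|i−j| > 1`, and diagonal
entries `P(i,i) = 1 − Σ_{j≠i} P(i,j)`. -/
noncomputable def metropolisChain (N : ℕ) (w : ℕ → ℝ) :
    Matrix (Fin N) (Fin N) ℝ := fun i j =>
  if i = j then
    1 - ∑ j' ∈ Finset.univ.erase i,
      (if i.val + 1 = j'.val ∨ j'.val + 1 = i.val then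
        (4 : ℝ)⁻¹ * min 1 (w (j'.val + 1) / w (i.val + 1)) else 0)
  else if i.val + 1 = j.val ∨ j.val + 1 = i.val then
    (4 : ℝ)⁻¹ * min 1 (w (j.val + 1) / w (i.val + 1))
  else 0

/-- A log-concave positive sequence is monotone to the left of an ascent. -/
lemma le_of_logConcave_of_ascent {N : ℕ} {a : ℕ → ℝ} (ha : ∀ i < N, 0 < a i)
    (hlc : ∀ i, i + 2 < N → a i * a (i + 2) ≤ a (i + 1) ^ 2) :
    ∀ k, k + 1 < N → a k ≤ a (k + 1) → ∀ i ≤ k, a i ≤ a k := by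
  intro k
  induction k with
  | zero =>
    intro _ _ i hi
    rw [Nat.le_zero.mp hi]
  | succ k ih =>
    intro hk h i hi
    rcases Nat.le_succ_iff.mp hi with hi | rfl
    · have h₂ : a k ≤ a (k + 1) := by
        have hlc' := hlc k hk
        have hp := ha (k + 1) (by omega)
        have hp' := ha (k + 2) hk
        have h' : a (k + 1) ≤ a (k + 2) := h
        refine le_of_mul_le_mul_right (?_ : a k * a (k + 2) ≤ a (k + 1) * a (k + 2)) hp'
        nlinarith
      exact (ih (by omega) h₂ i hi).trans h₂
    · exact le_rfl

/-- A log-concave positive sequence is antitone to the right of a descent. -/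
lemma le_of_logConcave_of_descent {N : ℕ} {a : ℕ → ℝ} (ha : ∀ i < N, 0 < a i)
    (hlc : ∀ i, i + 2 < N → a i * a (i + 2) ≤ a (i + 1) ^ 2) (k : ℕ)
    (h : a (k + 1) ≤ a k) (i : ℕ) (hi : k + 1 ≤ i) (hiN : i < N) : a i ≤ a (k + 1) := by
  suffices H : a i ≤ a (i - 1) ∧ a i ≤ a (k + 1) from H.2
  induction i, hi using Nat.le_induction with
  | base => exact ⟨h, le_rfl⟩
  | succ i hi ih =>
    obtain ⟨h₁, h₂⟩ := ih (by omega)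
    obtain ⟨j, rfl⟩ : ∃ j, i = j + 1 := ⟨i - 1, by omega⟩
    have hlc' := hlc j hiN
    have hp := ha j (by omega)
    have hp' := ha (j + 1) (by omega)
    have h₁' : a (j + 1) ≤ a j := h₁
    have h₃ : a (j + 2) ≤ a (j + 1) := by
      refine le_of_mul_le_mul_left (?_ : a j * a (j + 2) ≤ a j * a (j + 1)) hp
      nlinarith
    exact ⟨h₃, h₃.trans h₂⟩

/-- If `u` has zero mean for the log-concave weight `a`, its partial sums are controlled by the
smaller of the two weights at the cut. -/
lemma abs_sum_range_le_of_logConcave {N : ℕ} {a u : ℕ → ℝ} {M : ℝ} (ha : ∀ i < N, 0 < a i)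
    (hlc : ∀ i, i + 2 < N → a i * a (i + 2) ≤ a (i + 1) ^ 2)
    (h0 : ∑ i ∈ range N, a i * u i = 0) (hM : ∀ i < N, |u i| ≤ M) {k : ℕ} (hk : k + 1 < N) :
    |∑ i ∈ range (k + 1), a i * u i| ≤ N * (min (a k) (a (k + 1)) * M) := by
  have hM0 : 0 ≤ M := (abs_nonneg _).trans (hM 0 (by omega))
  have key : ∀ (s : Finset ℕ) (m : ℝ), 0 < m → s ⊆ range N → (∀ i ∈ s, a i ≤ m) →
      |∑ i ∈ s, a i * u i| ≤ N * (m * M) := by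
    intro s m hm hs hsm
    calc |∑ i ∈ s, a i * u i| ≤ ∑ i ∈ s, |a i * u i| := abs_sum_le_sum_abs _ _
      _ ≤ ∑ _i ∈ s, m * M := by
        refine sum_le_sum fun i hi => ?_
        have hiN := mem_range.mp (hs hi)
        rw [abs_mul, abs_of_pos (ha i hiN)]
        exact mul_le_mul (hsm i hi) (hM i hiN) (abs_nonneg _) hm.le
      _ = s.card * (m * M) := by rw [sum_const, nsmul_eq_mul]
      _ ≤ N * (m * M) := by
        have hc : s.card ≤ N := by simpa using card_le_card hs
        have : (s.card : ℝ) ≤ N := by exact_mod_cast hc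
        gcongr
  rcases le_total (a k) (a (k + 1)) with h | h
  · rw [min_eq_left h]
    refine key _ _ (ha k (by omega)) (range_subset_range.mpr hk.le) fun i hi => ?_
    exact le_of_logConcave_of_ascent ha hlc k hk h i (by simpa [Nat.lt_succ_iff] using hi)
  · rw [min_eq_right h]
    have hsplit := sum_range_add_sum_Ico (fun i => a i * u i) hk.le
    rw [h0, add_eq_zero_iff_eq_neg] at hsplit
    rw [hsplit, abs_neg]
    refine key _ _ (ha _ hk) (fun i hi => mem_range.mpr (mem_Ico.mp hi).2) fun i hi => ?_
    exact le_of_logConcave_of_descent ha hlc k h i (mem_Ico.mp hi).1 (mem_Ico.mp hi).2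

/-- A sequence with increments bounded by `D` on `{0,…,N-1}` has oscillation at most `N * D`. -/
lemma abs_sub_le_of_abs_increment_le {N : ℕ} {u : ℕ → ℝ} {D : ℝ} (hD : 0 ≤ D)
    (h : ∀ k, k + 1 < N → |u k - u (k + 1)| ≤ D) {i j : ℕ} (hi : i < N) (hj : j < N) :
    |u i - u j| ≤ N * D := by
  wlog hij : i ≤ j generalizing i j
  · rw [abs_sub_comm]
    exact this hj hi (by omega)
  have hdist := dist_le_Ico_sum_of_dist_le (f := u) (d := fun _ => D) hij
    (fun {k} _ hk => by rw [Real.dist_eq]; exact h k (by omega))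
  rw [Real.dist_eq, sum_const, Nat.card_Ico, nsmul_eq_mul] at hdist
  refine hdist.trans ?_
  have : ((j - i : ℕ) : ℝ) ≤ N := by exact_mod_cast (by omega : j - i ≤ N)
  gcongr

/-- The generator `P - 1` of the Metropolis chain, applied to a function. -/
lemma metropolisChain_mulVec_sub (N : ℕ) (w : ℕ → ℝ) (v : Fin N → ℝ) (i : Fin N) :
    v i - (metropolisChain N w).mulVec v i = ∑ j : Fin N,
      (if i.val + 1 = j.val ∨ j.val + 1 = i.val then
        (4 : ℝ)⁻¹ * min 1 (w (j.val + 1) / w (i.val + 1)) else 0) * (v i - v j) := by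
  rw [Matrix.mulVec, dotProduct, ← add_sum_erase _ _ (mem_univ i),
    ← add_sum_erase _ (fun j : Fin N => (if i.val + 1 = j.val ∨ j.val + 1 = i.val then
        (4 : ℝ)⁻¹ * min 1 (w (j.val + 1) / w (i.val + 1)) else 0) * (v i - v j)) (mem_univ i)]
  have hoff : ∑ j ∈ univ.erase i, metropolisChain N w i j * v j = ∑ j ∈ univ.erase i,
      (if i.val + 1 = j.val ∨ j.val + 1 = i.val then
        (4 : ℝ)⁻¹ * min 1 (w (j.val + 1) / w (i.val + 1)) else 0) * v j :=
    sum_congr rfl fun j hj => by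
      rw [metropolisChain, if_neg (ne_of_mem_erase hj).symm]
  rw [hoff, metropolisChain, if_pos rfl]
  simp only [mul_sub, sum_sub_distrib, ← sum_mul, sub_self]
  ring

/-- The flow of `u` across the edge `{k-1, k}`, extended by zero outside `{0,…,N-1}`. -/
noncomputable def metropolisFlow (N : ℕ) (a u : ℕ → ℝ) : ℕ → ℝ
  | 0 => 0
  | k + 1 => if k + 1 < N then min (a k) (a (k + 1)) / 4 * (u k - u (k + 1)) else 0

/-- The weighted generator is the discrete divergence of the flow. -/
lemma sum_metropolis_eq_flow_sub {N : ℕ} {a u : ℕ → ℝ} (ha : ∀ i < N, 0 < a i)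
    {i : ℕ} (hi : i < N) :
    a i * ∑ j ∈ range N, (if i + 1 = j ∨ j + 1 = i then
        (4 : ℝ)⁻¹ * min 1 (a j / a i) else 0) * (u i - u j) =
      metropolisFlow N a u (i + 1) - metropolisFlow N a u i := by
  have hmin : ∀ j, a i * min 1 (a j / a i) = min (a i) (a j) := fun j => by
    rw [mul_min_of_nonneg _ _ (ha i hi).le, mul_one, mul_div_cancel₀ _ (ha i hi).ne']
  have hterm : ∀ j, a i * ((if i + 1 = j ∨ j + 1 = i then
        (4 : ℝ)⁻¹ * min 1 (a j / a i) else 0) * (u i - u j)) =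
      (if i + 1 = j then min (a i) (a j) / 4 * (u i - u j) else 0) +
      (if j + 1 = i then min (a i) (a j) / 4 * (u i - u j) else 0) := fun j => by
    rw [← hmin j]
    split_ifs <;> first | omega | ring
  rw [mul_sum, sum_congr rfl fun j _ => hterm j, sum_add_distrib, sum_ite_eq]
  rcases i with _ | i
  · simp [metropolisFlow]
  · simp only [Nat.add_right_cancel_iff, sum_ite_eq', mem_range, metropolisFlow, hi,
      if_pos (Nat.lt_of_succ_lt hi), if_true, min_comm (a (i + 1)) (a i)]
    ring

/-- The largest ratio of neighbouring weights is at least one. -/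
lemma one_le_sSup_ratio {N : ℕ} (hN : 2 ≤ N) {w : ℕ → ℝ}
    (hpos : ∀ m, 1 ≤ m → m ≤ N → 0 < w m) :
    1 ≤ sSup {x : ℝ | ∃ m : ℕ, 1 ≤ m ∧ m < N ∧
      (x = w m / w (m + 1) ∨ x = w (m + 1) / w m)} := by
  have hfin : {x : ℝ | ∃ m : ℕ, 1 ≤ m ∧ m < N ∧
      (x = w m / w (m + 1) ∨ x = w (m + 1) / w m)}.Finite := by
    refine Set.Finite.subset (((range N).image fun m => w m / w (m + 1)) ∪
      ((range N).image fun m => w (m + 1) / w m)).finite_toSet ?_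
    rintro x ⟨m, _, hm, rfl | rfl⟩ <;> simp only [coe_union, coe_image, coe_range]
    · exact Or.inl ⟨m, hm, rfl⟩
    · exact Or.inr ⟨m, hm, rfl⟩
  have h₁ := hpos 1 le_rfl (by omega)
  have h₂ := hpos 2 (by omega) hN
  rcases le_total (w 1) (w 2) with h | h
  · exact ((one_le_div h₁).mpr h).trans
      (le_csSup hfin.bddAbove ⟨1, le_rfl, by omega, Or.inr rfl⟩)
  · exact ((one_le_div h₂).mpr h).trans
      (le_csSup hfin.bddAbove ⟨1, le_rfl, by omega, Or.inl rfl⟩)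

/-- Every eigenvalue of the Metropolis chain is at most one. -/
lemma metropolisChain_eigenvalue_le_one {N : ℕ} {w : ℕ → ℝ}
    (hpos : ∀ m, 1 ≤ m → m ≤ N → 0 < w m) {lam : ℝ} {v : Fin N → ℝ}
    (hv : (metropolisChain N w).mulVec v = lam • v) {i : Fin N} (hi : v i ≠ 0)
    (hmax : ∀ j, |v j| ≤ |v i|) : lam ≤ 1 := by
  have h := metropolisChain_mulVec_sub N w v i
  rw [hv, Pi.smul_apply, smul_eq_mul] at h
  have hnn : 0 ≤ (v i - lam * v i) * v i := by
    rw [h, sum_mul]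
    refine sum_nonneg fun j _ => ?_
    rw [mul_assoc]
    refine mul_nonneg ?_ ?_
    · split_ifs
      · have := (hpos (j.val + 1) (by omega) (by omega)).le
        have := (hpos (i.val + 1) (by omega) (by omega)).le
        positivity
      · exact le_rfl
    · have h₁ : v j * v i ≤ |v j| * |v i| := (le_abs_self _).trans (abs_mul _ _).le
      have h₂ := mul_le_mul_of_nonneg_right (hmax j) (abs_nonneg (v i))
      rw [abs_mul_abs_self] at h₂
      linarith
  have hsq : 0 < v i * v i := mul_self_pos.mpr hi
  by_contra! hlam
  nlinarith

/-- The spectral gap of the Metropolis chain of a log-concave sequence is at least `1/(4N²)`. -/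
lemma one_le_four_mul_sq_mul_gap {N : ℕ} {w : ℕ → ℝ}
    (hpos : ∀ m, 1 ≤ m → m ≤ N → 0 < w m)
    (hlc : ∀ m, 1 < m → m < N → w (m - 1) * w (m + 1) ≤ (w m) ^ 2)
    {lam : ℝ} {v : Fin N → ℝ} (hv0 : v ≠ 0)
    (hv : (metropolisChain N w).mulVec v = lam • v) (hlam : lam ≠ 1) :
    1 ≤ 4 * (N : ℝ) ^ 2 * (1 - lam) := by
  obtain ⟨i₀, hi₀⟩ := Function.ne_iff.mp hv0
  have : Nonempty (Fin N) := ⟨i₀⟩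
  obtain ⟨i, hmax⟩ := Finite.exists_max fun j => |v j|
  have hM : 0 < |v i| := (abs_pos.mpr hi₀).trans_le (hmax i₀)
  have hle := metropolisChain_eigenvalue_le_one hpos hv (abs_pos.mp hM) hmax
  set a : ℕ → ℝ := fun m => w (m + 1) with ha_def
  set u : ℕ → ℝ := fun m => if h : m < N then v ⟨m, h⟩ else 0 with hu_def
  have hu : ∀ j : Fin N, u j = v j := fun j => by simp [hu_def]
  have ha : ∀ j < N, 0 < a j := fun j hj => hpos (j + 1) (by omega) (by omega)
  have hlca : ∀ j, j + 2 < N → a j * a (j + 2) ≤ a (j + 1) ^ 2 := fun j hj =>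
    hlc (j + 2) (by omega) (by omega)
  have hdiv : ∀ j < N, (1 - lam) * (a j * u j) =
      metropolisFlow N a u (j + 1) - metropolisFlow N a u j := by
    intro j hj
    have h := metropolisChain_mulVec_sub N w v ⟨j, hj⟩
    rw [hv, Pi.smul_apply, smul_eq_mul] at h
    simp only [← hu] at h
    rw [Fin.sum_univ_eq_sum_range (fun k => (if j + 1 = k ∨ k + 1 = j then
        (4 : ℝ)⁻¹ * min 1 (w (k + 1) / w (j + 1)) else 0) * (u j - u k)) N] at h
    rw [← sum_metropolis_eq_flow_sub ha hj, ← h]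
    ring
  have hsum : ∀ k ≤ N, (1 - lam) * ∑ j ∈ range k, a j * u j = metropolisFlow N a u k := by
    intro k hk
    rw [mul_sum, sum_congr rfl fun j hj => hdiv j ((mem_range.mp hj).trans_le hk),
      sum_range_sub, metropolisFlow, sub_zero]
  have hgap : 0 < 1 - lam := sub_pos.mpr (lt_of_le_of_ne hle hlam)
  have h0 : ∑ j ∈ range N, a j * u j = 0 := by
    have h := hsum N le_rfl
    have hN : metropolisFlow N a u N = 0 := by cases N <;> simp [metropolisFlow]
    rw [hN] at h
    exact (mul_eq_zero.mp h).resolve_left hgap.ne'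
  have huM : ∀ j < N, |u j| ≤ |v i| := fun j hj => by
    have := hmax ⟨j, hj⟩
    rwa [← hu ⟨j, hj⟩] at this
  have hinc : ∀ k, k + 1 < N → |u k - u (k + 1)| ≤ 4 * (1 - lam) * N * |v i| := by
    intro k hk
    have hS := abs_sum_range_le_of_logConcave ha hlca h0 huM hk
    have hF := hsum (k + 1) hk.le
    rw [metropolisFlow, if_pos hk] at hF
    have hm : 0 < min (a k) (a (k + 1)) := lt_min (ha k (by omega)) (ha _ hk)
    have hF' := congrArg abs hF
    rw [abs_mul, abs_mul, abs_of_pos hgap, abs_of_pos (by positivity : 0 < _ / (4 : ℝ))] at hF'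
    have h := mul_le_mul_of_nonneg_left hS hgap.le
    rw [hF'] at h
    refine le_of_mul_le_mul_left ?_ (by positivity : 0 < min (a k) (a (k + 1)) / 4)
    linarith
  obtain ⟨j, hj, hsign⟩ : ∃ j < N, u j * v i ≤ 0 := by
    by_contra! hcon
    have hpos' : 0 < ∑ j ∈ range N, a j * (u j * v i) :=
      sum_pos (fun j hj => mul_pos (ha j (mem_range.mp hj)) (hcon j (mem_range.mp hj)))
        ⟨i, mem_range.mpr i.isLt⟩
    simp only [← mul_assoc, ← sum_mul, h0, zero_mul, lt_irrefl] at hpos'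
  have hosc := abs_sub_le_of_abs_increment_le
    (mul_nonneg (by positivity) hM.le) hinc i.isLt hj
  rw [hu] at hosc
  have hfar : |v i| ≤ |v i - u j| := by
    refine sq_le_sq.mp ?_
    nlinarith [sq_nonneg (u j)]
  have hfin := hfar.trans hosc
  refine le_of_mul_le_mul_right ?_ hM
  linarith

/-- Spectral gap bound for the Metropolis birth–death chain of a log-concave sequence:
every eigenvalue `λ ≠ 1` satisfies `λ ≤ 1 − 1/(4N³C)`, where
`C = max{w_i/w_j : |i−j| = 1}`. -/
theorem metropolis_gap_bound (N : ℕ) (hN : 2 ≤ N) (w : ℕ → ℝ)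
    (hpos : ∀ m, 1 ≤ m → m ≤ N → 0 < w m)
    (hlc : ∀ m, 1 < m → m < N → w (m - 1) * w (m + 1) ≤ (w m) ^ 2) :
    let C : ℝ := sSup {x : ℝ | ∃ m : ℕ, 1 ≤ m ∧ m < N ∧
      (x = w m / w (m + 1) ∨ x = w (m + 1) / w m)}
    ∀ (lam : ℝ) (v : Fin N → ℝ), v ≠ 0 →
      (metropolisChain N w).mulVec v = lam • v → lam ≠ 1 →
        lam ≤ 1 - 1 / (4 * (N : ℝ) ^ 3 * C) := by
  intro C lam v hv0 hv hlam
  have hC : 1 ≤ C := one_le_sSup_ratio hN hpos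
  have hgap := one_le_four_mul_sq_mul_gap hpos hlc hv0 hv hlam
  have hN1 : (1 : ℝ) ≤ N := by exact_mod_cast (by omega : 1 ≤ N)
  have hN0 : (0 : ℝ) < 4 * (N : ℝ) ^ 2 := by positivity
  have hbound : 4 * (N : ℝ) ^ 2 ≤ 4 * (N : ℝ) ^ 3 * C := by
    calc 4 * (N : ℝ) ^ 2 ≤ 4 * (N : ℝ) ^ 2 * (N * C) :=
          le_mul_of_one_le_right hN0.le (one_le_mul_of_one_le_of_one_le hN1 hC)
      _ = 4 * (N : ℝ) ^ 3 * C := by ring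
  have h₁ : 1 / (4 * (N : ℝ) ^ 3 * C) ≤ 1 / (4 * (N : ℝ) ^ 2) :=
    one_div_le_one_div_of_le hN0 hbound
  have h₂ : 1 / (4 * (N : ℝ) ^ 2) ≤ 1 - lam := by
    rw [div_le_iff₀ hN0]
    linarith
  linarith
end

section
/- Let n, m ∈ ℕ and let ℓ, u ∈ ℕⁿ with ℓᵢ ≤ uᵢ ≤ n − 1 for all i. Define the n-variable real polynomial p(x₁,…,xₙ) = Σ_{d ∈ D_m(ℓ,u)} (∏ᵢ C(n−1, dᵢ)) · ∏ᵢ xᵢ^{dᵢ}, where C(·,·) denotes a binomial coefficient; p is homogeneous of degree 2m and equals, up to a positive constant factor, the Liebenau–Wormald weight polynomial f̄(x) = Σ_{d ∈ D_m(ℓ,u)} z̄(d) x^d. Then p is strongly log-concave on the nonnegative orthant: for every multi-index β ∈ ℕⁿ, writing q = ∂^β p (the partial derivative of p taken βᵢ times in xᵢ for each i), and for every x ∈ ℝⁿ with xᵢ ≥ 0 for all i, the n×n real matrix M(x) with entries M(x)_{ij} = q(x)·(∂ᵢ∂ⱼ q)(x) − (∂ᵢ q)(x)·(∂ⱼ q)(x)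 is negative semidefinite. (Wherever q(x) > 0 this matrix condition is equivalent to the Hessian of log q being negative semidefinite at x.) -/
open MvPolynomial Finset

/-- `D_m(ℓ,u)` as a finite set of degree sequences. -/
noncomputable def Dm (n m : ℕ) (ℓ u : Fin n → ℕ) : Finset (Fin n → ℕ) :=
  (Finset.Icc ℓ u).filter (fun d => ∑ i, d i = 2 * m)

/-- The (rescaled) Liebenau–Wormald weight polynomial
`p(x) = Σ_{d ∈ D_m(ℓ,u)} (∏ᵢ C(n−1, dᵢ)) x^d`. -/
noncomputable def lwPoly (n m : ℕ) (ℓ u : Fin n → ℕ) : MvPolynomial (Fin n) ℝ :=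
  ∑ d ∈ Dm n m ℓ u,
    MvPolynomial.monomial (Finsupp.equivFunOnFinite.symm d)
      ((∏ i, Nat.choose (n - 1) (d i) : ℕ) : ℝ)

/-- The iterated partial derivative `∂^β`, differentiating `β i` times in variable `xᵢ`. -/
noncomputable def pderivPow {n : ℕ} (β : Fin n → ℕ) (p : MvPolynomial (Fin n) ℝ) :
    MvPolynomial (Fin n) ℝ :=
  (List.finRange n).foldr (fun i q => (fun r => MvPolynomial.pderiv i r)^[β i] q) p

open scoped Matrix

/-- A symmetric matrix `S` fixing `p` whose eigenvalues orthogonal to `p` lie outside `(0, ∞)` is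
bounded above by the orthogonal projection onto `p`. -/
lemma Matrix.dotProduct_mulVec_le_of_fixed {ι : Type*} [Fintype ι]
    (S : Matrix ι ι ℝ) (hS : S.IsSymm) (p : ι → ℝ) (hp : 0 < p ⬝ᵥ p) (hSp : S *ᵥ p = p)
    (hsq : ∀ v, v ⬝ᵥ S *ᵥ v ≤ (S *ᵥ v) ⬝ᵥ (S *ᵥ v))
    (hlt : ∀ v, p ⬝ᵥ v = 0 → v ⬝ᵥ v ≤ v ⬝ᵥ S *ᵥ v → v = 0) (v : ι → ℝ) :
    (p ⬝ᵥ p) * (v ⬝ᵥ S *ᵥ v) ≤ (p ⬝ᵥ v) ^ 2 := by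
  classical
  set T : Matrix ι ι ℝ := (p ⬝ᵥ p)⁻¹ • Matrix.vecMulVec p p - S with hT
  have hTv (w : ι → ℝ) : T *ᵥ w = ((p ⬝ᵥ p)⁻¹ * (p ⬝ᵥ w)) • p - S *ᵥ w := by
    rw [hT, Matrix.sub_mulVec, Matrix.smul_mulVec, Matrix.vecMulVec_mulVec]
    simp [smul_smul]
  have hTs : T.IsHermitian := by
    rw [Matrix.IsHermitian, Matrix.conjTranspose_eq_transpose_of_trivial, hT,
      Matrix.transpose_sub, hS.eq, Matrix.transpose_smul, Matrix.transpose_vecMulVec]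
  have hpS (w : ι → ℝ) : p ⬝ᵥ S *ᵥ w = p ⬝ᵥ w := by
    rw [Matrix.dotProduct_mulVec, ← Matrix.mulVec_transpose, hS.eq, hSp]
  have hpsd : T.PosSemidef := by
    rw [hTs.posSemidef_iff_eigenvalues_nonneg]
    intro j
    by_contra! hneg
    simp only [Pi.zero_apply] at hneg
    have heig := hTs.mulVec_eigenvectorBasis j
    set μ := hTs.eigenvalues j
    set e : ι → ℝ := (hTs.eigenvectorBasis j).ofLp with he
    have he0 : e ≠ 0 := by
      intro h0
      apply hTs.eigenvectorBasis.orthonormal.ne_zero j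
      ext i
      exact congrFun h0 i
    rw [hTv] at heig
    have hpe : p ⬝ᵥ e = 0 := by
      have h1 := congrArg (fun w => p ⬝ᵥ w) heig
      simp only [dotProduct_sub, dotProduct_smul, smul_eq_mul, hpS] at h1
      have h2 : (p ⬝ᵥ p)⁻¹ * (p ⬝ᵥ e) * (p ⬝ᵥ p) = p ⬝ᵥ e := by field_simp
      rw [h2, sub_self] at h1
      exact (mul_eq_zero.mp h1.symm).resolve_left hneg.ne
    have hSe : S *ᵥ e = (-μ) • e := by
      rw [hpe, mul_zero, zero_smul, zero_sub] at heig
      rw [neg_smul, ← heig, neg_neg]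
    have hee : 0 < e ⬝ᵥ e := by
      have := dotProduct_star_self_pos_iff.mpr he0
      simpa using this
    have h1 := hsq e
    rw [hSe] at h1
    simp only [dotProduct_smul, smul_dotProduct, smul_eq_mul] at h1
    have h2 : 1 ≤ -μ := by
      by_contra! h3
      nlinarith [mul_pos (mul_pos (neg_pos.mpr hneg) hee) (sub_pos.mpr h3)]
    refine he0 (hlt e hpe ?_)
    rw [hSe, dotProduct_smul, smul_eq_mul]
    nlinarith
  have h1 := hpsd.dotProduct_mulVec_nonneg v
  rw [hTv, star_trivial, dotProduct_sub, dotProduct_smul, smul_eq_mul, dotProduct_comm v p,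
    inv_mul_eq_div, div_mul_eq_mul_div, sub_nonneg, le_div_iff₀ hp] at h1
  nlinarith

/-- The Bochner criterion: a symmetric matrix with positive entries satisfying `A ≤ A²` after
normalisation to a Markov kernel fixing `x` has exactly one positive eigenvalue. -/
lemma Matrix.hyperbolic_of_bochner {ι : Type*} [Fintype ι] [Nonempty ι]
    (H : Matrix ι ι ℝ) (hH : H.IsSymm) (hpos : ∀ i j, 0 < H i j) (x : ι → ℝ) (hx : ∀ i, 0 < x i)
    (hb : ∀ v, v ⬝ᵥ H *ᵥ v ≤ ∑ i, x i * ((H *ᵥ v) i ^ 2 / (H *ᵥ x) i)) (v : ι → ℝ) :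
    (v ⬝ᵥ H *ᵥ v) * (x ⬝ᵥ H *ᵥ x) ≤ (v ⬝ᵥ H *ᵥ x) ^ 2 := by
  classical
  set r := H *ᵥ x with hr
  have hr0 (i : ι) : 0 < r i :=
    Finset.sum_pos (fun j _ => mul_pos (hpos i j) (hx j)) Finset.univ_nonempty
  set s : ι → ℝ := fun i => √(r i / x i) with hs
  have hs0 (i : ι) : 0 < s i := Real.sqrt_pos.mpr (div_pos (hr0 i) (hx i))
  have hs2 (i : ι) : s i ^ 2 = r i / x i := Real.sq_sqrt (div_pos (hr0 i) (hx i)).le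
  have hs2x (i : ι) : s i ^ 2 * x i = r i := by rw [hs2, div_mul_cancel₀ _ (hx i).ne']
  set S : Matrix ι ι ℝ := fun i j => H i j / (s i * s j) with hS
  set p : ι → ℝ := fun i => s i * x i with hp
  have hSv (w : ι → ℝ) (i : ι) : (S *ᵥ w) i = (H *ᵥ fun j => w j / s j) i / s i := by
    simp only [Matrix.mulVec, dotProduct, hS, Finset.sum_div]
    refine Finset.sum_congr rfl fun j _ => ?_
    have := (hs0 i).ne'; have := (hs0 j).ne'
    field_simp
  have hq (w : ι → ℝ) : w ⬝ᵥ S *ᵥ w = (fun j => w j / s j) ⬝ᵥ H *ᵥ fun j => w j / s j := by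
    simp only [dotProduct, hSv]
    exact Finset.sum_congr rfl fun i _ => by ring
  have hpx : (fun j => p j / s j) = x := by
    ext j; simp only [hp]; rw [mul_div_cancel_left₀ _ (hs0 j).ne']
  have hpp : p ⬝ᵥ p = x ⬝ᵥ r := by
    refine Finset.sum_congr rfl fun i _ => ?_
    rw [← hs2x]; simp only [hp]; ring
  have key := Matrix.dotProduct_mulVec_le_of_fixed S ?_ p ?_ ?_ ?_ ?_ (fun i => s i * v i)
  · have h1 : (fun j => s j * v j / s j) = v := by
      ext j; rw [mul_div_cancel_left₀ _ (hs0 j).ne']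
    have h2 : p ⬝ᵥ (fun i => s i * v i) = v ⬝ᵥ r := by
      refine Finset.sum_congr rfl fun i _ => ?_
      rw [← hs2x]; simp only [hp]; ring
    rw [hq, h1, h2, hpp] at key
    linarith
  · ext i j
    change H j i / (s j * s i) = H i j / (s i * s j)
    rw [hH.apply, mul_comm]
  · rw [hpp]
    exact Finset.sum_pos (fun i _ => mul_pos (hx i) (hr0 i)) Finset.univ_nonempty
  · ext i
    rw [hSv, hpx, ← hr, div_eq_iff (hs0 i).ne', ← hs2x]
    simp only [hp]; ring
  · intro w
    rw [hq]
    refine (hb _).trans (Finset.sum_le_sum fun i _ => le_of_eq ?_)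
    rw [hSv, ← hs2x]
    have := (hs0 i).ne'; have := (hx i).ne'
    field_simp
  · intro w hpw hw
    set z : ι → ℝ := fun i => w i / s i / x i with hz
    have hwz (i : ι) : w i = s i * x i * z i := by
      have := (hs0 i).ne'; have := (hx i).ne'
      simp only [hz]; field_simp
    have hww : w ⬝ᵥ w = ∑ i, ∑ j, H i j * x i * x j * z i ^ 2 := by
      refine Finset.sum_congr rfl fun i _ => ?_
      have : r i = ∑ j, H i j * x j := rfl
      calc w i * w i = (s i ^ 2 * x i) * (x i * z i ^ 2) := by rw [hwz]; ring
        _ = _ := by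
          rw [hs2x, this, Finset.sum_mul]
          exact Finset.sum_congr rfl fun j _ => by ring
    have hww' : w ⬝ᵥ w = ∑ i, ∑ j, H i j * x i * x j * z j ^ 2 := by
      rw [hww, Finset.sum_comm]
      refine Finset.sum_congr rfl fun i _ => Finset.sum_congr rfl fun j _ => ?_
      rw [hH.apply]; ring
    have hwS : w ⬝ᵥ S *ᵥ w = ∑ i, ∑ j, H i j * x i * x j * (z i * z j) := by
      rw [hq]
      simp only [dotProduct, Matrix.mulVec, Finset.mul_sum]
      refine Finset.sum_congr rfl fun i _ => Finset.sum_congr rfl fun j _ => ?_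
      have := (hx i).ne'; have := (hx j).ne'
      simp only [hz]; field_simp
    have hE : ∑ i, ∑ j, H i j * x i * x j * (z i - z j) ^ 2 =
        2 * (w ⬝ᵥ w) - 2 * (w ⬝ᵥ S *ᵥ w) := by
      have : 2 * (w ⬝ᵥ w) = w ⬝ᵥ w + w ⬝ᵥ w := two_mul _
      rw [this]
      nth_rewrite 1 [hww]
      rw [hww', hwS]
      simp only [Finset.mul_sum, ← Finset.sum_add_distrib, ← Finset.sum_sub_distrib]
      exact Finset.sum_congr rfl fun i _ => Finset.sum_congr rfl fun j _ => by ring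
    have hnn (i j : ι) : 0 ≤ H i j * x i * x j * (z i - z j) ^ 2 :=
      mul_nonneg (mul_pos (mul_pos (hpos i j) (hx i)) (hx j)).le (sq_nonneg _)
    have hE0 : ∑ i, ∑ j, H i j * x i * x j * (z i - z j) ^ 2 = 0 :=
      le_antisymm (by rw [hE]; linarith)
        (Finset.sum_nonneg fun i _ => Finset.sum_nonneg fun j _ => hnn i j)
    have hconst (i j : ι) : z i = z j := by
      have h1 := (Finset.sum_eq_zero_iff_of_nonneg
        (fun i _ => Finset.sum_nonneg fun j _ => hnn i j)).mp hE0 i (Finset.mem_univ i)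
      have h2 := (Finset.sum_eq_zero_iff_of_nonneg (fun j _ => hnn i j)).mp h1 j (Finset.mem_univ j)
      have h3 := (mul_eq_zero.mp h2).resolve_left
        (mul_pos (mul_pos (hpos i j) (hx i)) (hx j)).ne'
      exact sub_eq_zero.mp (pow_eq_zero_iff two_ne_zero |>.mp h3)
    obtain ⟨k⟩ := ‹Nonempty ι›
    have hwp : w = z k • p := by
      ext i; rw [hwz, hconst i k, Pi.smul_apply, smul_eq_mul]; simp only [hp]; ring
    have hp0 : 0 < p ⬝ᵥ p := by
      rw [hpp]
      exact Finset.sum_pos (fun i _ => mul_pos (hx i) (hr0 i)) ⟨k, Finset.mem_univ k⟩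
    rw [hwp, dotProduct_smul, smul_eq_mul] at hpw
    rw [hwp, (mul_eq_zero.mp hpw).resolve_right hp0.ne', zero_smul]

section LogConcaveProduct

variable {ι : Type*} [DecidableEq ι]

/-- Shift the `j`-th weight sequence by one. -/
def shiftWeight (j : ι) (w : ι → ℕ → ℝ) (i : ι) (d : ℕ) : ℝ :=
  w i (d + if i = j then 1 else 0)

/-- Families of positive log-concave sequences. -/
def PosLogConcave (w : ι → ℕ → ℝ) : Prop :=
  (∀ i d, 0 < w i d) ∧ ∀ i d, w i d * w i (d + 2) ≤ w i (d + 1) ^ 2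

lemma PosLogConcave.shiftWeight {w : ι → ℕ → ℝ} (hw : PosLogConcave w) (j : ι) :
    PosLogConcave (shiftWeight j w) :=
  ⟨fun _ _ => hw.1 _ _, fun i d => by
    have := hw.2 i (d + if i = j then 1 else 0)
    simpa only [_root_.shiftWeight, add_right_comm] using this⟩

lemma shiftWeight_comm (i j : ι) (w : ι → ℕ → ℝ) :
    shiftWeight i (shiftWeight j w) = shiftWeight j (shiftWeight i w) := by
  ext l d
  simp only [shiftWeight, add_right_comm]

variable [Fintype ι]

/-- The degree `k` part of `∏ᵢ Σ_d wᵢ(d) xᵢ^d / d!`. -/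
noncomputable def expProd (w : ι → ℕ → ℝ) (k : ℕ) : MvPolynomial ι ℝ :=
  ∑ d ∈ Finset.univ.finsuppAntidiag k, monomial d (∏ i, w i (d i) / (d i).factorial)

lemma coeff_expProd (w : ι → ℕ → ℝ) (k : ℕ) (d : ι →₀ ℕ) :
    coeff d (expProd w k) = if ∑ i, d i = k then ∏ i, w i (d i) / (d i).factorial else 0 := by
  simp [expProd, coeff_sum, coeff_monomial, Finset.mem_finsuppAntidiag]

lemma expProd_isHomogeneous (w : ι → ℕ → ℝ) (k : ℕ) : (expProd w k).IsHomogeneous k := by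
  intro d hd
  rw [coeff_expProd] at hd
  have := (ite_ne_right_iff.mp hd).1
  rw [← this, Finsupp.weight_apply, Finsupp.sum_fintype _ _ (by simp)]
  simp

lemma pderiv_expProd_succ (w : ι → ℕ → ℝ) (k : ℕ) (j : ι) :
    pderiv j (expProd w (k + 1)) = expProd (shiftWeight j w) k := by
  ext d
  rw [coeff_pderiv, coeff_expProd, coeff_expProd]
  have hsum : ∑ i, (d + Finsupp.single j 1 : ι →₀ ℕ) i = ∑ i, d i + 1 := by
    simp [Finset.sum_add_distrib, Finsupp.single_apply]
  rw [hsum]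
  by_cases h : ∑ i, d i = k
  · rw [if_pos (by rw [h]), if_pos h, ← Finset.mul_prod_erase _ _ (Finset.mem_univ j),
      ← Finset.mul_prod_erase _ _ (Finset.mem_univ j), mul_right_comm]
    congr 1
    · have : ((d j).factorial : ℝ) ≠ 0 := by positivity
      have : (d j : ℝ) + 1 ≠ 0 := by positivity
      simp only [shiftWeight, Finsupp.add_apply, Finsupp.single_eq_same, if_true,
        Nat.factorial_succ, Nat.cast_mul, Nat.cast_add, Nat.cast_one]
      field_simp
    · refine Finset.prod_congr rfl fun i hi => ?_
      have hij := Finset.ne_of_mem_erase hi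
      simp [shiftWeight, hij]
  · rw [if_neg (by omega), if_neg h, zero_mul]

lemma pderiv_expProd_zero (w : ι → ℕ → ℝ) (j : ι) : pderiv j (expProd w 0) = 0 := by
  ext d
  rw [coeff_pderiv, coeff_expProd, if_neg, zero_mul, coeff_zero]
  simp [Finset.sum_add_distrib, Finsupp.single_apply]

lemma eval_expProd (w : ι → ℕ → ℝ) (k : ℕ) (x : ι → ℝ) :
    eval x (expProd w k) = ∑ d ∈ Finset.univ.finsuppAntidiag k,
      (∏ i, w i (d i) / (d i).factorial) * ∏ i, x i ^ d i := by
  simp only [expProd, map_sum, eval_monomial]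
  refine Finset.sum_congr rfl fun d _ => ?_
  rw [Finsupp.prod_fintype _ _ (by simp)]

lemma eval_expProd_zero (w : ι → ℕ → ℝ) (x : ι → ℝ) :
    eval x (expProd w 0) = ∏ i, w i 0 := by
  simp [eval_expProd]

lemma eval_expProd_pos [Nonempty ι] {w : ι → ℕ → ℝ} (hw : ∀ i d, 0 < w i d) (k : ℕ) {x : ι → ℝ}
    (hx : ∀ i, 0 < x i) : 0 < eval x (expProd w k) := by
  rw [eval_expProd]
  refine Finset.sum_pos (fun d _ => mul_pos (Finset.prod_pos fun i _ => ?_)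
    (Finset.prod_pos fun i _ => pow_pos (hx i) _)) ?_
  · exact div_pos (hw _ _) (by positivity)
  · obtain ⟨i⟩ := ‹Nonempty ι›
    exact ⟨Finsupp.single i k, by simp [Finset.mem_finsuppAntidiag, Finsupp.single_apply]⟩

/-- Euler's identity for `expProd`. -/
lemma sum_mul_eval_shiftWeight (w : ι → ℕ → ℝ) (k : ℕ) (x : ι → ℝ) :
    ∑ j, x j * eval x (expProd (shiftWeight j w) k) = (k + 1) * eval x (expProd w (k + 1)) := by
  have := congrArg (eval x) (expProd_isHomogeneous w (k + 1)).sum_X_mul_pderiv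
  simpa [pderiv_expProd_succ] using this

/-- The Hessian of `expProd w (k + 2)` at `x`. -/
noncomputable def expProdHessian (w : ι → ℕ → ℝ) (k : ℕ) (x : ι → ℝ) : Matrix ι ι ℝ :=
  Matrix.of fun i j => eval x (expProd (shiftWeight i (shiftWeight j w)) k)

lemma expProdHessian_mulVec_self (w : ι → ℕ → ℝ) (k : ℕ) (x : ι → ℝ) (i : ι) :
    (expProdHessian w k x *ᵥ x) i = (k + 1) * eval x (expProd (shiftWeight i w) (k + 1)) := by
  rw [← sum_mul_eval_shiftWeight]
  refine Finset.sum_congr rfl fun j _ => ?_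
  rw [shiftWeight_comm]
  exact mul_comm _ _

lemma dotProduct_expProdHessian_self (w : ι → ℕ → ℝ) (k : ℕ) (x : ι → ℝ) :
    x ⬝ᵥ expProdHessian w k x *ᵥ x = (k + 1) * ((k + 2) * eval x (expProd w (k + 2))) := by
  have := sum_mul_eval_shiftWeight w (k + 1) x
  push_cast at this
  rw [show (k : ℝ) + 2 = k + 1 + 1 by ring, ← this, Finset.mul_sum]
  refine Finset.sum_congr rfl fun i _ => ?_
  rw [expProdHessian_mulVec_self]; ring

lemma expProdHessian_isSymm (w : ι → ℕ → ℝ) (k : ℕ) (x : ι → ℝ) :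
    (expProdHessian w k x).IsSymm := by
  ext i j
  simp only [expProdHessian, Matrix.transpose_apply, Matrix.of_apply]
  rw [shiftWeight_comm]

lemma expProdHessian_pos [Nonempty ι] {w : ι → ℕ → ℝ} (hw : ∀ i d, 0 < w i d) (k : ℕ) {x : ι → ℝ}
    (hx : ∀ i, 0 < x i) (i j : ι) : 0 < expProdHessian w k x i j :=
  eval_expProd_pos (fun _ _ => hw _ _) k hx

/-- Euler's identity for the Hessian of `expProd`. -/
lemma sum_smul_expProdHessian_shiftWeight (w : ι → ℕ → ℝ) (k : ℕ) (x : ι → ℝ) :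
    ∑ i, x i • expProdHessian (shiftWeight i w) k x =
      ((k : ℝ) + 1) • expProdHessian w (k + 1) x := by
  ext j l
  rw [Matrix.sum_apply]
  simp only [Matrix.smul_apply, smul_eq_mul, expProdHessian, Matrix.of_apply]
  rw [← sum_mul_eval_shiftWeight]
  refine Finset.sum_congr rfl fun i _ => ?_
  rw [shiftWeight_comm i j, shiftWeight_comm i l]

/-- The entries of the Hessian of a quadratic `expProd`. -/
lemma expProdHessian_zero {w : ι → ℕ → ℝ} (hw : ∀ i d, 0 < w i d) (x : ι → ℝ) (i j : ι) :
    expProdHessian w 0 x i j = (∏ l, w l 0) * (w i 1 / w i 0 * (w j 1 / w j 0) -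
      if i = j then (w i 1 ^ 2 - w i 0 * w i 2) / w i 0 ^ 2 else 0) := by
  have h0 (l : ι) : w l 0 ≠ 0 := (hw l 0).ne'
  rw [expProdHessian, Matrix.of_apply, eval_expProd_zero]
  have hprod (i : ι) : ∏ l, w l 0 = w i 0 * ∏ l ∈ Finset.univ.erase i, w l 0 :=
    (Finset.mul_prod_erase _ _ (Finset.mem_univ i)).symm
  have := h0 i
  have := h0 j
  by_cases hij : i = j
  · subst hij
    rw [if_pos rfl, hprod i, ← Finset.mul_prod_erase _ _ (Finset.mem_univ i)]
    have : ∏ l ∈ Finset.univ.erase i, shiftWeight i (shiftWeight i w) l 0 =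
        ∏ l ∈ Finset.univ.erase i, w l 0 :=
      Finset.prod_congr rfl fun l hl => by simp [shiftWeight, Finset.ne_of_mem_erase hl]
    rw [this]
    simp only [shiftWeight, if_true, zero_add, Nat.reduceAdd]
    field_simp
    ring
  · have hj : j ∈ Finset.univ.erase i := Finset.mem_erase.mpr ⟨Ne.symm hij, Finset.mem_univ j⟩
    rw [if_neg hij, hprod i, ← Finset.mul_prod_erase _ _ (Finset.mem_univ i),
      ← Finset.mul_prod_erase _ _ hj, ← Finset.mul_prod_erase _ _ hj]
    have : ∏ l ∈ (Finset.univ.erase i).erase j, shiftWeight i (shiftWeight j w) l 0 =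
        ∏ l ∈ (Finset.univ.erase i).erase j, w l 0 :=
      Finset.prod_congr rfl fun l hl => by
        rw [Finset.mem_erase, Finset.mem_erase] at hl
        simp [shiftWeight, hl.1, hl.2.1]
    rw [this]
    simp only [shiftWeight, if_true, if_neg hij, if_neg (Ne.symm hij), zero_add, add_zero]
    field_simp
    ring

lemma hyperbolic_expProdHessian_zero [Nonempty ι] {w : ι → ℕ → ℝ} (hw : PosLogConcave w)
    {x : ι → ℝ} (hx : ∀ i, 0 < x i) (v : ι → ℝ) :
    (v ⬝ᵥ expProdHessian w 0 x *ᵥ v) * (x ⬝ᵥ expProdHessian w 0 x *ᵥ x) ≤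
      (v ⬝ᵥ expProdHessian w 0 x *ᵥ x) ^ 2 := by
  set H := expProdHessian w 0 x with hH
  set a : ι → ℝ := fun i => w i 1 / w i 0
  set c : ι → ℝ := fun i => (w i 1 ^ 2 - w i 0 * w i 2) / w i 0 ^ 2
  set W := ∏ l, w l 0
  have hW : 0 < W := Finset.prod_pos fun l _ => hw.1 l 0
  have hc0 (i : ι) : 0 ≤ c i := div_nonneg (sub_nonneg.mpr (hw.2 i 0)) (sq_nonneg _)
  have hax : 0 < a ⬝ᵥ x :=
    Finset.sum_pos (fun i _ => mul_pos (div_pos (hw.1 i 1) (hw.1 i 0)) (hx i))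
      Finset.univ_nonempty
  have hxx : 0 < x ⬝ᵥ H *ᵥ x := by
    rw [hH, dotProduct_expProdHessian_self]
    have := eval_expProd_pos hw.1 (0 + 2) hx
    positivity
  have hform (u : ι → ℝ) : u ⬝ᵥ H *ᵥ u = W * ((a ⬝ᵥ u) ^ 2 - ∑ i, c i * u i ^ 2) := by
    rw [sq, dotProduct, dotProduct, Finset.sum_mul_sum, ← Finset.sum_sub_distrib, Finset.mul_sum]
    refine Finset.sum_congr rfl fun i _ => ?_
    simp only [Matrix.mulVec, dotProduct, hH, expProdHessian_zero hw.1, Finset.mul_sum]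
    have : c i * u i ^ 2 = ∑ j, if i = j then c i * u i * u j else 0 := by
      rw [Finset.sum_ite_eq, if_pos (Finset.mem_univ i)]; ring
    rw [this, ← Finset.sum_sub_distrib, Finset.mul_sum]
    refine Finset.sum_congr rfl fun j _ => ?_
    simp only [a, c, W]
    split_ifs <;> ring
  have hsymm : x ⬝ᵥ H *ᵥ v = v ⬝ᵥ H *ᵥ x := by
    rw [Matrix.dotProduct_mulVec, ← Matrix.mulVec_transpose, (expProdHessian_isSymm w 0 x).eq,
      dotProduct_comm]
  set t := (a ⬝ᵥ v) / (a ⬝ᵥ x) with ht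
  have hneg : (v - t • x) ⬝ᵥ H *ᵥ (v - t • x) ≤ 0 := by
    have h0 : a ⬝ᵥ (v - t • x) = 0 := by
      rw [dotProduct_sub, dotProduct_smul, smul_eq_mul, ht, div_mul_cancel₀ _ hax.ne', sub_self]
    rw [hform, h0]
    have := Finset.sum_nonneg fun i (_ : i ∈ Finset.univ) =>
      mul_nonneg (hc0 i) (sq_nonneg ((v - t • x) i))
    nlinarith
  simp only [Matrix.mulVec_sub, Matrix.mulVec_smul, dotProduct_sub, sub_dotProduct,
    dotProduct_smul, smul_dotProduct, smul_eq_mul, hsymm] at hneg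
  nlinarith [sq_nonneg (v ⬝ᵥ H *ᵥ x - t * (x ⬝ᵥ H *ᵥ x)), mul_nonneg hxx.le (neg_nonneg.mpr hneg)]

/-- The Hessian of `expProd` is hyperbolic on the positive orthant. -/
lemma hyperbolic_expProdHessian [Nonempty ι] (k : ℕ) {w : ι → ℕ → ℝ} (hw : PosLogConcave w)
    {x : ι → ℝ} (hx : ∀ i, 0 < x i) (v : ι → ℝ) :
    (v ⬝ᵥ expProdHessian w k x *ᵥ v) * (x ⬝ᵥ expProdHessian w k x *ᵥ x) ≤
      (v ⬝ᵥ expProdHessian w k x *ᵥ x) ^ 2 := by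
  induction k generalizing w v with
  | zero => exact hyperbolic_expProdHessian_zero hw hx v
  | succ k ih =>
    refine Matrix.hyperbolic_of_bochner _ (expProdHessian_isSymm w _ x)
      (expProdHessian_pos hw.1 _ hx) x hx (fun u => ?_) v
    have hk : (0 : ℝ) < k + 1 := by positivity
    refine le_of_mul_le_mul_left ?_ hk
    have hsum : ((k : ℝ) + 1) * (u ⬝ᵥ expProdHessian w (k + 1) x *ᵥ u) =
        ∑ i, x i * (u ⬝ᵥ expProdHessian (shiftWeight i w) k x *ᵥ u) := by
      rw [← smul_eq_mul, ← dotProduct_smul, ← Matrix.smul_mulVec,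
        ← sum_smul_expProdHessian_shiftWeight, Matrix.sum_mulVec, dotProduct_sum]
      simp only [Matrix.smul_mulVec, dotProduct_smul, smul_eq_mul]
    rw [hsum, Finset.mul_sum]
    refine Finset.sum_le_sum fun i _ => ?_
    have hi := ih (hw.shiftWeight i) u
    have hux : u ⬝ᵥ expProdHessian (shiftWeight i w) k x *ᵥ x =
        (k + 1) * (expProdHessian w (k + 1) x *ᵥ u) i := by
      simp only [dotProduct, Matrix.mulVec.eq_1 (expProdHessian w (k + 1) x), Finset.mul_sum]
      refine Finset.sum_congr rfl fun j _ => ?_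
      rw [expProdHessian_mulVec_self, shiftWeight_comm, expProdHessian, Matrix.of_apply]
      rw [shiftWeight_comm]; ring
    have hxx : x ⬝ᵥ expProdHessian (shiftWeight i w) k x *ᵥ x =
        (k + 1) * (expProdHessian w (k + 1) x *ᵥ x) i := by
      rw [dotProduct_expProdHessian_self, expProdHessian_mulVec_self]
      push_cast; ring
    have hr : 0 < (expProdHessian w (k + 1) x *ᵥ x) i :=
      Finset.sum_pos (fun j _ => mul_pos (expProdHessian_pos hw.1 _ hx i j) (hx j))
        Finset.univ_nonempty
    rw [hux, hxx] at hi
    rw [mul_left_comm]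
    refine mul_le_mul_of_nonneg_left ?_ (hx i).le
    rw [← mul_div_assoc, le_div_iff₀ hr]
    refine le_of_mul_le_mul_left ?_ hk
    linarith

/-- `expProd` of positive log-concave sequences is log-concave on the positive orthant. -/
lemma log_concave_expProd {w : ι → ℕ → ℝ} (hw : PosLogConcave w) (k : ℕ) {x : ι → ℝ}
    (hx : ∀ i, 0 < x i) (y : ι → ℝ) :
    ∑ i, ∑ j, y i * (eval x (expProd w k) * eval x (pderiv i (pderiv j (expProd w k))) -
      eval x (pderiv i (expProd w k)) * eval x (pderiv j (expProd w k))) * y j ≤ 0 := by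
  cases isEmpty_or_nonempty ι
  · simp
  have hsplit : ∑ i, ∑ j, y i * (eval x (expProd w k) * eval x (pderiv i (pderiv j (expProd w k))) -
      eval x (pderiv i (expProd w k)) * eval x (pderiv j (expProd w k))) * y j =
      eval x (expProd w k) * ∑ i, ∑ j, y i * (eval x (pderiv i (pderiv j (expProd w k))) * y j) -
      (∑ i, y i * eval x (pderiv i (expProd w k))) ^ 2 := by
    rw [sq, Finset.sum_mul_sum, Finset.mul_sum, ← Finset.sum_sub_distrib]
    refine Finset.sum_congr rfl fun i _ => ?_
    rw [Finset.mul_sum, ← Finset.sum_sub_distrib]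
    exact Finset.sum_congr rfl fun j _ => by ring
  rw [hsplit]
  rcases k with _ | _ | k
  · simp [pderiv_expProd_zero]
  · have h1 (i j : ι) : pderiv i (pderiv j (expProd w (0 + 1))) = 0 := by
      rw [pderiv_expProd_succ, pderiv_expProd_zero]
    simp only [h1, map_zero, zero_mul, mul_zero, Finset.sum_const_zero, zero_sub,
      Left.neg_nonpos_iff]
    exact sq_nonneg _
  · have hq := eval_expProd_pos hw.1 (k + 2) hx
    have key := hyperbolic_expProdHessian k hw hx y
    rw [dotProduct_expProdHessian_self] at key
    have h1 : ∑ i, ∑ j, y i * (eval x (pderiv i (pderiv j (expProd w (k + 2)))) * y j) =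
        y ⬝ᵥ expProdHessian w k x *ᵥ y := by
      simp only [dotProduct, Matrix.mulVec, Finset.mul_sum, expProdHessian, Matrix.of_apply,
        pderiv_expProd_succ]
    have h2 : y ⬝ᵥ expProdHessian w k x *ᵥ x =
        (k + 1) * ∑ i, y i * eval x (pderiv i (expProd w (k + 2))) := by
      simp only [dotProduct, Finset.mul_sum, expProdHessian_mulVec_self, pderiv_expProd_succ]
      exact Finset.sum_congr rfl fun i _ => by ring
    rw [h1]
    rw [h2] at key
    set A := y ⬝ᵥ expProdHessian w k x *ᵥ y
    set B := ∑ i, y i * eval x (pderiv i (expProd w (k + 2)))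
    set q := eval x (expProd w (k + 2))
    have hk : (0 : ℝ) < k + 1 := by positivity
    have h3 : ((k : ℝ) + 2) * (q * A) ≤ (k + 1) * B ^ 2 := by
      refine le_of_mul_le_mul_left ?_ hk
      linarith
    nlinarith [sq_nonneg B]

end LogConcaveProduct

section Perturbation

variable {ι : Type*} [Fintype ι] [DecidableEq ι]

/-- Continuous one-parameter families of polynomials that are either identically zero or of the
form `expProd` with weights that are positive and log-concave for parameters in `(0, 1]`. -/
def IsLogConcaveFamily (f : ℝ → MvPolynomial ι ℝ) : Prop :=
  (∀ ε, f ε = 0) ∨ ∃ (k : ℕ) (W : ℝ → ι → ℕ → ℝ), (∀ ε, f ε = expProd (W ε) k) ∧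
    (∀ ε, 0 < ε → ε ≤ 1 → PosLogConcave (W ε)) ∧ ∀ i d, Continuous fun ε => W ε i d

lemma IsLogConcaveFamily.pderiv {f : ℝ → MvPolynomial ι ℝ} (hf : IsLogConcaveFamily f) (j : ι) :
    IsLogConcaveFamily fun ε => MvPolynomial.pderiv j (f ε) := by
  rcases hf with hf | ⟨k, W, hfW, hW, hc⟩
  · exact Or.inl fun ε => by simp only [hf, map_zero]
  · cases k with
    | zero => exact Or.inl fun ε => by simp only [hfW, pderiv_expProd_zero]
    | succ k =>
      exact Or.inr ⟨k, fun ε => shiftWeight j (W ε),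
        fun ε => by simp only [hfW, pderiv_expProd_succ],
        fun ε h0 h1 => (hW ε h0 h1).shiftWeight j, fun i d => hc i _⟩

lemma IsLogConcaveFamily.pderivPow {n : ℕ} {f : ℝ → MvPolynomial (Fin n) ℝ}
    (hf : IsLogConcaveFamily f) (β : Fin n → ℕ) :
    IsLogConcaveFamily fun ε => pderivPow β (f ε) := by
  unfold _root_.pderivPow
  induction List.finRange n with
  | nil => exact hf
  | cons i l ih =>
    simp only [List.foldr_cons]
    induction β i with
    | zero => exact ih
    | succ b ihb =>
      simp only [Function.iterate_succ_apply']
      exact ihb.pderiv i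

lemma IsLogConcaveFamily.continuous_eval {f : ℝ → MvPolynomial ι ℝ} (hf : IsLogConcaveFamily f)
    (x : ι → ℝ) : Continuous fun ε : ℝ => eval (fun i => x i + ε) (f ε) := by
  rcases hf with hf | ⟨k, W, hfW, -, hc⟩
  · simp only [hf, map_zero]
    exact continuous_const
  · simp only [hfW, eval_expProd]
    fun_prop

/-- Log-concavity passes to the limit `ε → 0` and to the boundary of the orthant. -/
lemma IsLogConcaveFamily.log_concave_zero {f : ℝ → MvPolynomial ι ℝ} (hf : IsLogConcaveFamily f)
    {x : ι → ℝ} (hx : ∀ i, 0 ≤ x i) (y : ι → ℝ) :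
    ∑ i, ∑ j, y i * (eval x (f 0) * eval x (MvPolynomial.pderiv i (MvPolynomial.pderiv j (f 0))) -
      eval x (MvPolynomial.pderiv i (f 0)) * eval x (MvPolynomial.pderiv j (f 0))) * y j ≤ 0 := by
  set g : ℝ → ℝ := fun ε => ∑ i, ∑ j, y i * (eval (fun i => x i + ε) (f ε) *
    eval (fun i => x i + ε) (MvPolynomial.pderiv i (MvPolynomial.pderiv j (f ε))) -
      eval (fun i => x i + ε) (MvPolynomial.pderiv i (f ε)) *
        eval (fun i => x i + ε) (MvPolynomial.pderiv j (f ε))) * y j with hg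
  have hcont : Continuous g := by
    have h0 := hf.continuous_eval x
    have h1 (i : ι) := (hf.pderiv i).continuous_eval x
    have h2 (i j : ι) := ((hf.pderiv j).pderiv i).continuous_eval x
    exact continuous_finsetSum _ fun i _ => continuous_finsetSum _ fun j _ =>
      (continuous_const.mul ((h0.mul (h2 i j)).sub ((h1 i).mul (h1 j)))).mul continuous_const
  have hneg : ∀ ε ∈ Set.Ioc (0 : ℝ) 1, g ε ≤ 0 := by
    rintro ε ⟨h0, h1⟩
    rcases hf with hf | ⟨k, W, hfW, hW, -⟩
    · simp [hg, hf]
    · simp only [hg, hfW]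
      exact log_concave_expProd (hW ε h0 h1) k (fun i => by have := hx i; positivity) y
  have hlim := (hcont.tendsto 0).mono_left (nhdsWithin_le_nhds (s := Set.Ioi 0))
  have key := le_of_tendsto hlim
    (Filter.eventually_of_mem (Ioc_mem_nhdsGT zero_lt_one) hneg)
  simpa [hg] using key

end Perturbation

/-- The weights `N! / (N - d)!`, damped by powers of `ε` outside the interval `[ℓ, u]`. -/
noncomputable def dampedWeight (N ℓ u : ℕ) (ε : ℝ) (d : ℕ) : ℝ :=
  ε ^ ((ℓ - d) + (d - u)) * (N.factorial / (N - d).factorial)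

lemma factorial_sub_log_convex (N d : ℕ) :
    (N - (d + 1)).factorial ^ 2 ≤ (N - d).factorial * (N - (d + 2)).factorial := by
  rcases lt_or_ge N (d + 2) with h | h
  · have h1 : N - (d + 1) = 0 := by omega
    have h2 : N - (d + 2) = 0 := by omega
    rw [h1, h2]
    simpa using Nat.one_le_iff_ne_zero.mpr (N - d).factorial_ne_zero
  · obtain ⟨b, rfl⟩ := Nat.exists_eq_add_of_le h
    rw [show d + 2 + b - (d + 1) = b + 1 by omega, show d + 2 + b - d = b + 1 + 1 by omega,
      show d + 2 + b - (d + 2) = b by omega, Nat.factorial_succ (b + 1), Nat.factorial_succ b]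
    nlinarith [Nat.zero_le ((b + 1) * b.factorial ^ 2)]

lemma posLogConcave_dampedWeight {ι : Type*} (N : ℕ) (ℓ u : ι → ℕ) {ε : ℝ} (h0 : 0 < ε)
    (h1 : ε ≤ 1) : PosLogConcave fun i => dampedWeight N (ℓ i) (u i) ε := by
  refine ⟨fun i d => by unfold dampedWeight; positivity, fun i d => ?_⟩
  have hpow : ε ^ ((ℓ i - d) + (d - u i)) * ε ^ ((ℓ i - (d + 2)) + (d + 2 - u i)) ≤
      (ε ^ ((ℓ i - (d + 1)) + (d + 1 - u i))) ^ 2 := by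
    rw [← pow_add, ← pow_mul]
    exact pow_le_pow_of_le_one h0.le h1 (by omega)
  have hfac : (N.factorial / (N - d).factorial : ℝ) * (N.factorial / (N - (d + 2)).factorial) ≤
      (N.factorial / (N - (d + 1)).factorial) ^ 2 := by
    rw [div_mul_div_comm, div_pow, ← sq]
    refine div_le_div_of_nonneg_left (by positivity) (by positivity) ?_
    exact_mod_cast factorial_sub_log_convex N d
  have := mul_le_mul hpow hfac (by positivity) (by positivity)
  calc _ = _ := by unfold dampedWeight; ring
    _ ≤ _ := this
    _ = _ := by unfold dampedWeight; ring

lemma dampedWeight_zero_div_factorial {N ℓ u : ℕ} (hu : u ≤ N) (d : ℕ) :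
    dampedWeight N ℓ u 0 d / d.factorial = if ℓ ≤ d ∧ d ≤ u then (N.choose d : ℝ) else 0 := by
  unfold dampedWeight
  split_ifs with h
  · rw [show (ℓ - d) + (d - u) = 0 by omega, pow_zero, one_mul,
      Nat.cast_choose ℝ (h.2.trans hu), div_div, mul_comm]
  · rw [zero_pow (by omega), zero_mul, zero_div]

lemma expProd_dampedWeight_zero {n : ℕ} (m : ℕ) {ℓ u : Fin n → ℕ} (hu : ∀ i, u i ≤ n - 1) :
    expProd (fun i => dampedWeight (n - 1) (ℓ i) (u i) 0) (2 * m) = lwPoly n m ℓ u := by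
  ext d
  have hdm : (⇑d ∈ Dm n m ℓ u) ↔ (∀ i, ℓ i ≤ d i ∧ d i ≤ u i) ∧ ∑ i, d i = 2 * m := by
    simp [Dm, Pi.le_def, forall_and]
  have hlw : coeff d (lwPoly n m ℓ u) =
      if ⇑d ∈ Dm n m ℓ u then ((∏ i, Nat.choose (n - 1) (d i) : ℕ) : ℝ) else 0 := by
    simp only [lwPoly, coeff_sum, coeff_monomial, Equiv.symm_apply_eq]
    exact Finset.sum_ite_eq' _ _ _
  rw [hlw, coeff_expProd]
  simp only [dampedWeight_zero_div_factorial (hu _), Finset.prod_ite_zero, Finset.mem_univ,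
    forall_true_left, hdm, Nat.cast_prod]
  split_ifs <;> tauto

/-- The Liebenau–Wormald weight polynomial is strongly log-concave on the nonnegative
orthant: for every multi-index `β` and every nonnegative point `x`, the matrix
`M(x)_{ij} = q(x)·(∂ᵢ∂ⱼq)(x) − (∂ᵢq)(x)·(∂ⱼq)(x)` (with `q = ∂^β p`) is negative
semidefinite. -/
theorem lwPoly_strongly_log_concave (n m : ℕ) (ℓ u : Fin n → ℕ)
    (h : ∀ i, ℓ i ≤ u i ∧ u i ≤ n - 1) (β : Fin n → ℕ)
    (x : Fin n → ℝ) (hx : ∀ i, 0 ≤ x i) :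
    ∀ y : Fin n → ℝ,
      ∑ i, ∑ j, y i *
        (MvPolynomial.eval x (pderivPow β (lwPoly n m ℓ u)) *
            MvPolynomial.eval x
              (MvPolynomial.pderiv i (MvPolynomial.pderiv j (pderivPow β (lwPoly n m ℓ u)))) -
          MvPolynomial.eval x (MvPolynomial.pderiv i (pderivPow β (lwPoly n m ℓ u))) *
            MvPolynomial.eval x (MvPolynomial.pderiv j (pderivPow β (lwPoly n m ℓ u)))) * y j
        ≤ 0 := by
  have hfam : IsLogConcaveFamily fun ε =>
      expProd (fun i => dampedWeight (n - 1) (ℓ i) (u i) ε) (2 * m) :=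
    Or.inr ⟨_, _, fun _ => rfl, fun _ h0 h1 => posLogConcave_dampedWeight _ ℓ u h0 h1,
      fun i d => by unfold dampedWeight; fun_prop⟩
  intro y
  have key := (hfam.pderivPow β).log_concave_zero hx y
  rwa [expProd_dampedWeight_zero m fun i => (h i).2] at key
end
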